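/- Let K be the function field of a smooth projective curve over ℂ((t)), let n ≥ 1 be an integer, let f ∈ K^×, let α be an n-th root of f in a fixed algebraic closure of K, and set L := K(α); the extension L/K is Galois, since ℂ ⊆ K contains all n-th roots of unity. If all but finitely many places of K are totally split in L/K, then every place of K is totally split in L/K. -/

import Mathlib

open Polynomial

universe u

lemma ValuationSubring.exists_comap_algebraMap_eq {K L : Type*} [Field K] [Field L] [Algebra K L]
    (v : ValuationSubring K) : ∃ B : ValuationSubring L, B.comap (algebraMap K L) = v := by
  obtain ⟨B, hB⟩ := (v.toLocalSubring.map (algebraMap K L)).exists_le_valuationSubring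
  refine ⟨B, ?_⟩
  apply ValuationSubring.toLocalSubring_injective
  symm
  refine (ValuationSubring.isMax_toLocalSubring v).eq_of_le ?_
  obtain ⟨h1, h2⟩ := hB
  refine ⟨fun a ha => h1 ⟨a, ha, rfl⟩, ⟨?_⟩⟩
  rintro ⟨a, ha⟩ hu
  have h3 := h2.1 ⟨algebraMap K L a, ⟨a, ha, rfl⟩⟩ (by
    obtain ⟨⟨b, hb⟩, hab⟩ := hu.exists_right_inv
    have hab' : a * b = 1 := congrArg Subtype.val hab
    refine IsUnit.of_mul_eq_one ⟨algebraMap K L b, hb⟩ ?_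
    apply Subtype.ext
    change algebraMap K L a * algebraMap K L b = 1
    rw [← map_mul, hab', map_one])
  obtain ⟨⟨b, b', hb', rfl⟩, hab⟩ := h3.exists_right_inv
  have hab' : algebraMap K L a * algebraMap K L b' = 1 := congrArg Subtype.val hab
  refine IsUnit.of_mul_eq_one ⟨b', hb'⟩ ?_
  apply Subtype.ext
  change a * b' = 1
  apply (algebraMap K L).injective
  rw [map_mul, hab', map_one]

lemma ValuationSubring.valuation_lt_one_iff_inv_notMem {K : Type*} [Field K]
    (v : ValuationSubring K) {a : K} (ha : a ≠ 0) : v.valuation a < 1 ↔ a⁻¹ ∉ v := by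
  rw [← v.valuation_le_one_iff, map_inv₀, not_le,
    one_lt_inv₀ (by rwa [zero_lt_iff, Valuation.ne_zero_iff])]

lemma ValuationSubring.valuation_comap_lt_one_iff {K L : Type*} [Field K] [Field L]
    (B : ValuationSubring L) (φ : K →+* L) (a : K) :
    (B.comap φ).valuation a < 1 ↔ B.valuation (φ a) < 1 := by
  rcases eq_or_ne a 0 with rfl | ha
  · simp
  · rw [valuation_lt_one_iff_inv_notMem _ ha,
      valuation_lt_one_iff_inv_notMem _ ((map_ne_zero φ).2 ha), mem_comap, map_inv₀]

lemma ValuationSubring.valuation_eq_one_of_mem {K : Type*} [Field K] (v : ValuationSubring K)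
    {a : K} (ha : a ≠ 0) (h1 : a ∈ v) (h2 : a⁻¹ ∈ v) : v.valuation a = 1 := by
  refine le_antisymm ((v.valuation_le_one_iff a).2 h1) ?_
  by_contra h
  exact (v.valuation_lt_one_iff_inv_notMem ha).1 (not_le.1 h) h2

lemma pow_sub_one_eq_prod_complex {L : Type*} [Field L] (j : ℂ →+* L) {n : ℕ} (hn : 0 < n) (r : L) :
    r ^ n - 1 = ∏ μ ∈ Polynomial.nthRootsFinset n (1 : ℂ), (r - j μ) := by
  have h1 := Polynomial.X_pow_sub_one_eq_prod hn (Complex.isPrimitiveRoot_exp n hn.ne')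
  have h2 := congrArg (Polynomial.eval₂ j r) h1
  simpa [Polynomial.eval₂_finsetProd] using h2

/-- An automorphism acting on an `n`-th root of `g` through a nontrivial constant root of unity
cannot stabilize a valuation ring in which `g` is, up to `n`-th powers, congruent to `1`. -/
lemma ValuationSubring.not_sub_one_lt_one_of_map_eq {L : Type*} [Field L] (B : ValuationSubring L)
    (j : ℂ →+* L) (hj : ∀ c, j c ∈ B) (σ : L →+* L)
    (hσB : ∀ a, B.valuation a < 1 → B.valuation (σ a) < 1) (hσj : ∀ c, σ (j c) = j c)
    {α h : L} (hσh : σ h = h) {ω : ℂ} (hω : ω ≠ 1) (hσα : σ α = j ω * α) {n : ℕ} (hn : 0 < n) :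
    ¬ B.valuation (α ^ n / h ^ n - 1) < 1 := by
  intro hlt
  have hju : ∀ c : ℂ, c ≠ 0 → B.valuation (j c) = 1 := fun c hc =>
    B.valuation_eq_one_of_mem ((map_ne_zero j).2 hc) (hj c) (by rw [← map_inv₀]; exact hj _)
  set r := α / h with hr
  rw [← div_pow, pow_sub_one_eq_prod_complex j hn, map_prod] at hlt
  obtain ⟨μ, hμ, hμlt⟩ : ∃ μ ∈ Polynomial.nthRootsFinset n (1 : ℂ), B.valuation (r - j μ) < 1 := by
    by_contra! hcon
    exact absurd hlt (not_lt.2 (Finset.one_le_prod hcon))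
  have hμ0 : μ ≠ 0 := by
    rw [Polynomial.mem_nthRootsFinset hn] at hμ
    rintro rfl
    simp [hn.ne'] at hμ
  have h1 := hσB _ hμlt
  rw [map_sub, hσj, hr, map_div₀, hσα, hσh, mul_div_assoc, ← hr] at h1
  have hω0 : ω - 1 ≠ 0 := sub_ne_zero.2 hω
  have hω1 : B.valuation (j ω) ≤ 1 := (B.valuation_le_one_iff _).2 (hj ω)
  have h2 : B.valuation (j ω * (r - j μ)) < 1 := by
    rw [map_mul]
    exact mul_lt_one_of_nonneg_of_lt_one_right hω1 zero_le hμlt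
  have h3 := Valuation.map_sub_lt B.valuation h1 h2
  have h4 : j ω * r - j μ - j ω * (r - j μ) = j ((ω - 1) * μ) := by
    simp only [map_mul, map_sub, map_one]; ring
  rw [h4, hju _ (mul_ne_zero hω0 hμ0)] at h3
  exact lt_irrefl _ h3

/-- If `g` is a unit of `v` whose residue is not a `p`-th power, the `v`-integral elements of an
extension generated by a `p`-th root `α` of `g` are the `v`-combinations of powers of `α`. -/
lemma ValuationSubring.coeff_mem_of_aeval_mem {K L : Type*} [Field K] [Field L] [Algebra K L]
    (B : ValuationSubring L) {p : ℕ} (hp : p.Prime) {α : L} {g : K}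
    (hα : α ^ p = algebraMap K L g) (hg : (B.comap (algebraMap K L)).valuation g = 1)
    (hgp : ∀ h : K, ¬ (B.comap (algebraMap K L)).valuation (g - h ^ p) < 1)
    (P : Polynomial K) (hP : P.degree < p) (hPB : Polynomial.aeval α P ∈ B) (i : ℕ) :
    P.coeff i ∈ B.comap (algebraMap K L) := by
  set v := B.comap (algebraMap K L) with hv
  by_contra hi
  let f : v →+* B := ((algebraMap K L).comp v.subtype).codRestrict B.toSubring (fun a => a.2)
  have hf : IsLocalHom f := by
    constructor
    rintro ⟨a, ha⟩ hu
    have h0 : a ≠ 0 := by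
      rintro rfl
      exact hu.ne_zero (Subtype.ext (map_zero (algebraMap K L)))
    obtain ⟨⟨b, hb⟩, hab⟩ := hu.exists_right_inv
    have hab' : algebraMap K L a * b = 1 := congrArg Subtype.val hab
    refine IsUnit.of_mul_eq_one ⟨a⁻¹, ?_⟩ (Subtype.ext (mul_inv_cancel₀ h0))
    rw [hv, mem_comap, map_inv₀, inv_eq_of_mul_eq_one_right hab']
    exact hb
  let ρ : IsLocalRing.ResidueField v →+* IsLocalRing.ResidueField B :=
    IsLocalRing.ResidueField.map f
  have hgv : g ∈ v := (v.valuation_le_one_iff _).1 hg.le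
  have hαB : α ∈ B := by
    rw [← B.valuation_le_one_iff, ← pow_le_one_iff hp.ne_zero, ← map_pow, hα,
      B.valuation_le_one_iff]
    exact hgv
  have hirr : Irreducible (Polynomial.X ^ p -
      Polynomial.C (IsLocalRing.residue v ⟨g, hgv⟩)) := by
    refine X_pow_sub_C_irreducible_of_prime hp ?_
    intro b hb
    obtain ⟨⟨h, hh⟩, rfl⟩ := IsLocalRing.residue_surjective b
    refine hgp h ?_
    rw [← map_pow, eq_comm, ← sub_eq_zero, ← map_sub, IsLocalRing.residue_eq_zero_iff,
      ValuationSubring.valuation_lt_one_iff] at hb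
    exact hb
  have hne : P.support.Nonempty := by
    rw [Polynomial.support_nonempty]
    rintro rfl
    exact hi (by simp [v.zero_mem])
  obtain ⟨m, hm, hmax⟩ := P.support.exists_max_image (fun i => v.valuation (P.coeff i)) hne
  set a := P.coeff m with ha
  have ha0 : a ≠ 0 := Polynomial.mem_support_iff.1 hm
  have hmax' : ∀ i, v.valuation (P.coeff i) ≤ v.valuation a := by
    intro i
    by_cases h : i ∈ P.support
    · exact hmax i h
    · rw [Polynomial.notMem_support_iff.1 h, map_zero]; exact zero_le
  have hav : a ∉ v := fun h => hi ((v.valuation_le_one_iff _).1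
    ((hmax' i).trans ((v.valuation_le_one_iff _).2 h)))
  have hmem : ∀ i, (a⁻¹ * P.coeff i) ∈ v := by
    intro i
    rw [← v.valuation_le_one_iff, map_mul, map_inv₀]
    have : v.valuation a ≠ 0 := (Valuation.ne_zero_iff _).2 ha0
    calc _ ≤ (v.valuation a)⁻¹ * v.valuation a := by gcongr; exact hmax' i
      _ = 1 := inv_mul_cancel₀ this
  have hlift : Polynomial.C a⁻¹ * P ∈ Polynomial.lifts v.subtype := by
    rw [Polynomial.lifts_iff_coeff_lifts]
    intro i
    rw [Polynomial.coeff_C_mul]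
    exact ⟨⟨_, hmem i⟩, rfl⟩
  obtain ⟨Q, hQ⟩ := (Polynomial.mem_lifts _).1 hlift
  have hQc : ∀ i, (Q.coeff i : K) = a⁻¹ * P.coeff i := by
    intro i
    have := congrArg (fun q => Polynomial.coeff q i) hQ
    simpa using this
  have hainv : B.valuation (algebraMap K L a⁻¹) < 1 := by
    rw [← valuation_comap_lt_one_iff, ← hv, v.valuation_lt_one_iff_inv_notMem (inv_ne_zero ha0),
      inv_inv]
    exact hav
  have hQα : Polynomial.eval₂ f ⟨α, hαB⟩ Q ∈ IsLocalRing.maximalIdeal B := by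
    rw [ValuationSubring.valuation_lt_one_iff]
    have : ((Polynomial.eval₂ f ⟨α, hαB⟩ Q : B) : L) = algebraMap K L a⁻¹ * Polynomial.aeval α P := by
      have h1 : B.subtype (Polynomial.eval₂ f ⟨α, hαB⟩ Q) =
          Polynomial.eval₂ (algebraMap K L) α (Q.map v.subtype) := by
        rw [Polynomial.hom_eval₂, Polynomial.eval₂_map]; rfl
      rw [hQ] at h1
      rw [show ((Polynomial.eval₂ f ⟨α, hαB⟩ Q : B) : L) = B.subtype _ from rfl, h1,
        Polynomial.eval₂_mul, Polynomial.eval₂_C, Polynomial.aeval_def]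
    rw [this, map_mul]
    exact mul_lt_one_of_nonneg_of_lt_one_left zero_le hainv ((B.valuation_le_one_iff _).2 hPB)
  have hQbar0 : Q.map (IsLocalRing.residue v) ≠ 0 := by
    intro h0
    have h1 := congrArg (fun q => Polynomial.coeff q m) h0
    have h2 : Q.coeff m = 1 := Subtype.ext (by rw [hQc, ← ha, inv_mul_cancel₀ ha0]; rfl)
    simp [h2] at h1
  have hQdeg : (Q.map (IsLocalRing.residue v)).degree < p := by
    refine lt_of_le_of_lt (Polynomial.degree_map_le) (lt_of_le_of_lt ?_ hP)
    rw [Polynomial.degree_le_iff_coeff_zero]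
    intro i hi
    refine Subtype.ext ?_
    rw [hQc, Polynomial.coeff_eq_zero_of_degree_lt hi, mul_zero]; rfl
  have hcop : IsCoprime (Polynomial.X ^ p - Polynomial.C (IsLocalRing.residue v ⟨g, hgv⟩))
      (Q.map (IsLocalRing.residue v)) := by
    rw [hirr.coprime_iff_not_dvd]
    intro hdvd
    have := Polynomial.degree_le_of_dvd hdvd hQbar0
    rw [Polynomial.degree_X_pow_sub_C hp.pos] at this
    exact absurd hQdeg (not_lt.2 this)
  obtain ⟨u, w, huw⟩ := hcop
  have h1 := congrArg (Polynomial.eval₂ ρ (IsLocalRing.residue B ⟨α, hαB⟩)) huw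
  have h2 : Polynomial.eval₂ ρ (IsLocalRing.residue B ⟨α, hαB⟩)
      (Q.map (IsLocalRing.residue v)) = 0 := by
    rw [Polynomial.eval₂_map, ← (IsLocalRing.residue_eq_zero_iff _).2 hQα, Polynomial.hom_eval₂]
    rfl
  have h3 : Polynomial.eval₂ ρ (IsLocalRing.residue B ⟨α, hαB⟩)
      (Polynomial.X ^ p - Polynomial.C (IsLocalRing.residue v ⟨g, hgv⟩)) = 0 := by
    rw [Polynomial.eval₂_sub, Polynomial.eval₂_pow, Polynomial.eval₂_X, Polynomial.eval₂_C,
      sub_eq_zero, ← map_pow]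
    change _ = IsLocalRing.residue B (f ⟨g, hgv⟩)
    congr 1
    exact Subtype.ext hα
  rw [Polynomial.eval₂_add, Polynomial.eval₂_mul, Polynomial.eval₂_mul, h2, h3,
    Polynomial.eval₂_one] at h1
  simp at h1

lemma finiteDimensional_of_trdeg_le_one (k E K : Type u) [Field k] [Field E] [Field K]
    [Algebra k E] [Algebra k K] [Algebra E K] [IsScalarTower k E K] [Algebra.EssFiniteType k K]
    [Algebra.Transcendental k E] (h : Algebra.trdeg k K ≤ 1) : FiniteDimensional E K := by
  have h1 := trdeg_add_eq k E (A := K)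
  have h2 : 0 < Algebra.trdeg k E := trdeg_pos k E
  rw [← Cardinal.one_le_iff_pos] at h2
  have h3 : Algebra.trdeg E K = 0 := by
    have h4 : 1 + Algebra.trdeg E K ≤ 1 + 0 := by
      rw [add_zero]
      exact (add_le_add_left h2 _).trans (h1.le.trans h)
    rwa [add_comm, add_comm 1, Cardinal.add_le_add_iff_of_lt_aleph0 Cardinal.one_lt_aleph0,
      nonpos_iff_eq_zero] at h4
  have := trdeg_eq_zero_iff.1 h3
  have := Algebra.EssFiniteType.of_comp k E K
  exact Algebra.finite_of_essFiniteType_of_isAlgebraic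

lemma RatFunc.essFiniteType (k : Type u) [Field k] : Algebra.EssFiniteType k (RatFunc k) := by
  have : Algebra.EssFiniteType k[X] (RatFunc k) := .of_isLocalization _ (nonZeroDivisors _)
  exact .comp k k[X] (RatFunc k)

instance RatFunc.algebraTranscendental (k : Type u) [Field k] :
    Algebra.Transcendental k (RatFunc k) :=
  ⟨RatFunc.X, RatFunc.transcendental_X⟩

lemma RatFunc.trdeg_eq_one (k : Type u) [Field k] : Algebra.trdeg k (RatFunc k) = 1 := by
  have h1 := trdeg_add_eq k k[X] (A := RatFunc k)
  have : Algebra.IsAlgebraic k[X] (RatFunc k) := IsLocalization.isAlgebraic _ (nonZeroDivisors k[X])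
  rw [trdeg_eq_zero (R := k[X]) (A := RatFunc k), Polynomial.trdeg_of_isDomain, add_zero] at h1
  exact h1.symm

lemma essFiniteType_and_trdeg_of_finite (k K : Type u) [Field k] [Field K] [Algebra k K]
    [Algebra (RatFunc k) K] [IsScalarTower k (RatFunc k) K] [FiniteDimensional (RatFunc k) K] :
    Algebra.EssFiniteType k K ∧ Algebra.trdeg k K = 1 := by
  constructor
  · have := RatFunc.essFiniteType k
    exact .comp k (RatFunc k) K
  · rw [← trdeg_add_eq k (RatFunc k) (A := K), trdeg_eq_zero (R := RatFunc k) (A := K), add_zero,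
      RatFunc.trdeg_eq_one]

section ValuationRing

variable (k V : Type u) (K : Type u) [Field k] [Field K] [CommRing V]
  [Algebra V K] [IsFractionRing V K] [Algebra k V] [Algebra k K] [IsScalarTower k V K]

lemma transcendental_of_not_isUnit [IsIntegrallyClosed V] {f : V} (hf0 : f ≠ 0)
    (hf : ¬ IsUnit f) : Transcendental k (algebraMap V K f) := by
  intro h
  have h1 : IsIntegral V (algebraMap V K f)⁻¹ := (h.inv.isIntegral).tower_top
  obtain ⟨y, hy⟩ := IsIntegrallyClosed.isIntegral_iff.1 h1
  refine hf (IsUnit.of_mul_eq_one y (IsFractionRing.injective V K ?_))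
  rw [map_mul, hy, map_one, mul_inv_cancel₀]
  rwa [Ne, IsFractionRing.to_map_eq_zero_iff]

/-- The embedding of the rational function field sending `X` to a transcendental element. -/
noncomputable def RatFunc.liftTranscendental {k K : Type u} [Field k] [Field K] [Algebra k K]
    {x : K} (hx : Transcendental k x) : RatFunc k →ₐ[k] K :=
  IsFractionRing.liftAlgHom (A := k[X]) (g := aeval x) (transcendental_iff_injective.1 hx)

lemma RatFunc.liftTranscendental_algebraMap {k K : Type u} [Field k] [Field K] [Algebra k K]
    {x : K} (hx : Transcendental k x) (p : k[X]) :
    RatFunc.liftTranscendental hx (algebraMap k[X] (RatFunc k) p) = aeval x p :=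
  IsFractionRing.lift_algebraMap (transcendental_iff_injective.1 hx) _

lemma finite_quotient_span_singleton [IsDomain V] [IsIntegrallyClosed V] [Algebra.EssFiniteType k K]
    (htr : Algebra.trdeg k K ≤ 1) {f : V} (hf0 : f ≠ 0) (hf : ¬ IsUnit f) :
    Module.Finite k (V ⧸ Ideal.span {f}) := by
  have hft := transcendental_of_not_isUnit k V K hf0 hf
  let := (RatFunc.liftTranscendental hft).toRingHom.toAlgebra
  have : IsScalarTower k (RatFunc k) K := .of_algebraMap_eq fun a =>
    ((RatFunc.liftTranscendental hft).commutes a).symm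
  let : Algebra k[X] K := (aeval (algebraMap V K f)).toRingHom.toAlgebra
  have : IsScalarTower k[X] (RatFunc k) K := .of_algebraMap_eq fun a =>
    (RatFunc.liftTranscendental_algebraMap hft a).symm
  have hfd : FiniteDimensional (RatFunc k) K := finiteDimensional_of_trdeg_le_one k _ K htr
  rw [← Module.rank_lt_aleph0_iff]
  refine lt_of_le_of_lt (rank_le (n := Module.finrank (RatFunc k) K) ?_) (Cardinal.natCast_lt_aleph0)
  intro s hs
  choose a ha using fun i : s => Ideal.Quotient.mk_surjective i.1
  have hli : LinearIndependent k[X] (fun i => algebraMap V K (a i)) := by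
    rw [Fintype.linearIndependent_iff]
    intro p hp
    have hpV : ∑ i, aeval f (p i) * a i = 0 := by
      apply IsFractionRing.injective V K
      rw [map_sum, map_zero, ← hp]
      refine Finset.sum_congr rfl fun i _ => ?_
      rw [map_mul, ← aeval_algebraMap_apply, Algebra.smul_def]
      rfl
    have hdiv : ∀ n, ∀ i, (X : k[X]) ^ n ∣ p i := by
      intro n
      induction n with
      | zero => simp
      | succ n ih =>
        choose q hq using ih
        have h1 : f ^ n * ∑ i, aeval f (q i) * a i = 0 := by
          rw [← hpV, Finset.mul_sum]
          refine Finset.sum_congr rfl fun i _ => ?_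
          rw [hq i]; simp [mul_assoc]
        have h2 := (mul_eq_zero.1 h1).resolve_left (pow_ne_zero _ hf0)
        have h3 : ∑ i, (q i).coeff 0 • (i.1 : V ⧸ Ideal.span {f}) = 0 := by
          have h4 := congrArg (Ideal.Quotient.mk (Ideal.span {f})) h2
          rw [map_zero, map_sum] at h4
          rw [← h4]
          refine Finset.sum_congr rfl fun i _ => ?_
          rw [map_mul, ha, Algebra.smul_def]
          congr 1
          rw [← Ideal.Quotient.mkₐ_eq_mk k, ← aeval_algHom_apply]
          have h5 : Ideal.Quotient.mkₐ k (Ideal.span {f}) f = 0 := by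
            rw [Ideal.Quotient.mkₐ_eq_mk, Ideal.Quotient.eq_zero_iff_mem]
            exact Ideal.mem_span_singleton_self f
          rw [h5, ← coeff_zero_eq_aeval_zero']
        intro i
        have h4 := Fintype.linearIndependent_iff.1 hs _ h3 i
        rw [hq i, pow_succ]
        exact mul_dvd_mul_left _ (X_dvd_iff.2 h4)
    intro i
    by_contra hne
    have h1 := natDegree_le_of_dvd (hdiv ((p i).natDegree + 1) i) hne
    simp at h1
  have h1 := ((LinearIndependent.iff_fractionRing k[X] (RatFunc k)).1 hli).fintype_card_le_finrank
  simpa using h1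

lemma isNoetherianRing_of_trdeg_le_one [IsDomain V] [IsIntegrallyClosed V] [Algebra.EssFiniteType k K]
    (htr : Algebra.trdeg k K ≤ 1) : IsNoetherianRing V := by
  refine ⟨fun I => ?_⟩
  by_cases hI : I = ⊥
  · rw [hI]; exact Submodule.fg_bot
  obtain ⟨f, hfI, hf0⟩ := Submodule.exists_mem_ne_zero_of_ne_bot hI
  by_cases hf : IsUnit f
  · rw [Ideal.eq_top_of_isUnit_mem I hfI hf]
    exact Module.Finite.fg_top
  have h1 := finite_quotient_span_singleton k V K htr hf0 hf
  have h2 : IsNoetherian k (V ⧸ Ideal.span {f}) := inferInstance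
  have h3 : IsNoetherian V (V ⧸ Ideal.span {f}) := isNoetherian_of_tower k h2
  refine Submodule.fg_of_fg_map_of_fg_inf_ker (Submodule.mkQ (Ideal.span {f}))
    (IsNoetherian.noetherian (R := V) (M := V ⧸ Ideal.span {f}) _) ?_
  rw [Submodule.ker_mkQ, inf_eq_right.2]
  · exact Submodule.fg_span (Set.finite_singleton f)
  · rwa [Ideal.span_singleton_le_iff_mem]

lemma isDiscreteValuationRing_of_trdeg_le_one [IsDomain V] [ValuationRing V] [Algebra.EssFiniteType k K]
    (htr : Algebra.trdeg k K ≤ 1) (hV : ¬ IsField V) : IsDiscreteValuationRing V := by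
  have := isNoetherianRing_of_trdeg_le_one k V K htr
  exact ((IsDiscreteValuationRing.TFAE V hV).out 0 1 rfl rfl).2 (inferInstance : ValuationRing V)

lemma finite_residueField_of_trdeg_le_one [IsDomain V] [IsDiscreteValuationRing V] [Algebra.EssFiniteType k K]
    (htr : Algebra.trdeg k K ≤ 1) : Module.Finite k (IsLocalRing.ResidueField V) := by
  obtain ⟨x, hx⟩ := IsDiscreteValuationRing.exists_irreducible V
  have h1 := finite_quotient_span_singleton k V K htr hx.ne_zero hx.not_isUnit
  rw [← hx.maximalIdeal_eq] at h1
  exact h1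

end ValuationRing

lemma Polynomial.algHom_aevalAeval {k A B : Type*} [CommRing k] [CommRing A] [CommRing B]
    [Algebra k A] [Algebra k B] (f : A →ₐ[k] B) (x y : A) (F : k[X][X]) :
    f (aevalAeval x y F) = aevalAeval (f x) (f y) F := by
  have : f.comp (aevalAeval x y) = aevalAeval (f x) (f y) := by
    apply Polynomial.algHom_ext'
    · ext; simp
    · simp
  exact DFunLike.congr_fun this F

section Approximation

open IsLocalRing

variable {k V : Type*} [Field k] [CommRing V] [IsDomain V] [IsDiscreteValuationRing V]
  [Algebra k V]

lemma IsDiscreteValuationRing.exists_section [Algebra.FormallySmooth k (ResidueField V)] {x : V}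
    (hx : Irreducible x) (N : ℕ) (hN : N ≠ 0) :
    ∃ σ : ResidueField V →ₐ[k] V ⧸ Ideal.span {x ^ N},
      ∀ a z, σ a = Ideal.Quotient.mk _ z → residue V z = a := by
  have hle : Ideal.span {x ^ N} ≤ IsLocalRing.maximalIdeal V := by
    rw [hx.maximalIdeal_eq, Ideal.span_singleton_le_span_singleton]
    exact dvd_pow_self _ hN
  let g : V ⧸ Ideal.span {x ^ N} →ₐ[k] ResidueField V :=
    Ideal.Quotient.factorₐ k hle
  have hg : ∀ z, g (Ideal.Quotient.mk _ z) = residue V z := fun z => rfl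
  have hgs : Function.Surjective g := Ideal.Quotient.factor_surjective hle
  have hgn : IsNilpotent (RingHom.ker (g : V ⧸ Ideal.span {x ^ N} →+* ResidueField V)) := by
    refine ⟨N, ?_⟩
    have : RingHom.ker (g : V ⧸ Ideal.span {x ^ N} →+* ResidueField V) ≤
        Ideal.span {Ideal.Quotient.mk _ x} := by
      intro z hz
      obtain ⟨z, rfl⟩ := Ideal.Quotient.mk_surjective z
      have h1 : residue V z = 0 := hz
      rw [residue_eq_zero_iff, hx.maximalIdeal_eq, Ideal.mem_span_singleton] at h1
      rw [Ideal.mem_span_singleton]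
      exact map_dvd _ h1
    have h2 := Ideal.pow_right_mono this N
    rw [Ideal.span_singleton_pow, ← map_pow,
      Ideal.Quotient.eq_zero_iff_mem.2 (Ideal.mem_span_singleton_self _), Ideal.span_singleton_zero] at h2
    exact le_bot_iff.1 h2
  refine ⟨Algebra.FormallySmooth.liftOfSurjective (AlgHom.id k _) g hgs hgn, fun a z h => ?_⟩
  rw [← hg, ← h]
  exact Algebra.FormallySmooth.liftOfSurjective_apply (AlgHom.id k _) g hgs hgn a

/-- Any element of a discrete valuation ring over `k` is approximated by a polynomial in the
uniformizer over the residue field, compatibly with polynomial relations over `k`. -/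
lemma IsDiscreteValuationRing.exists_polynomial_approx
    [Algebra.FormallySmooth k (ResidueField V)] {x : V}
    (hx : Irreducible x) (N : ℕ) (y : V) :
    ∃ y₀ : (ResidueField V)[X], ∀ (F : k[X][X]) (i : ℕ) (w : V), i < N →
      aevalAeval x y F = x ^ i * w → ∃ f : (ResidueField V)[X],
        aevalAeval X y₀ F = X ^ i * f ∧ f.coeff 0 = residue V w := by
  rcases eq_or_ne N 0 with rfl | hN
  · exact ⟨0, by simp⟩
  obtain ⟨σ, hσ⟩ := exists_section (k := k) hx N hN
  let π : V →ₐ[k] V ⧸ Ideal.span {x ^ N} := Ideal.Quotient.mkₐ k _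
  have hπs : Function.Surjective π := Ideal.Quotient.mk_surjective
  have hπ : ∀ z, π z = Ideal.Quotient.mk _ z := fun z => rfl
  have hπ0 : ∀ z, π z = 0 ↔ x ^ N ∣ z := fun z => by
    rw [hπ, Ideal.Quotient.eq_zero_iff_mem, Ideal.mem_span_singleton]
  have hres : ∀ z : V, residue V z = 0 ↔ x ∣ z := fun z => by
    rw [residue_eq_zero_iff, hx.maximalIdeal_eq, Ideal.mem_span_singleton]
  let τ : (ResidueField V)[X] →ₐ[k] V ⧸ Ideal.span {x ^ N} :=
    eval₂AlgHom σ (π x) (fun _ => Commute.all _ _)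
  have hτX : τ X = π x := eval₂_X _ _
  have hτC : ∀ a, τ (C a) = σ a := fun a => eval₂_C _ _
  have hτ0 : ∀ (h : (ResidueField V)[X]) z, τ h = π z → residue V z = h.coeff 0 := by
    intro h z hz
    obtain ⟨q, hq⟩ := hπs (τ h.divX)
    rw [← divX_mul_X_add h, map_add, map_mul, hτX, hτC, ← hq, ← map_mul, ← eq_sub_iff_add_eq',
      ← map_sub] at hz
    have := hσ _ _ hz
    rw [map_sub, map_mul, (hres x).2 dvd_rfl, mul_zero, sub_zero] at this
    exact this
  have hsurj : ∀ j ≤ N, ∃ y₀ z, τ y₀ = π (y - x ^ j * z) := by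
    intro j
    induction j with
    | zero => exact fun _ => ⟨0, y, by simp⟩
    | succ j ih =>
      intro hj
      obtain ⟨y₀, z, hz⟩ := ih (by omega)
      obtain ⟨a, ha⟩ := hπs (σ (residue V z))
      have h1 := hσ _ _ ha.symm
      obtain ⟨b, hb⟩ := (hres (z - a)).1 (by rw [map_sub, h1, sub_self])
      refine ⟨y₀ + X ^ j * C (residue V z), b, ?_⟩
      rw [map_add, hz, map_mul, map_pow, hτX, hτC, ← ha, ← map_pow, ← map_mul, ← map_add,
        pow_succ, mul_assoc, ← hb]
      congr 1; ring
  have hker : ∀ m ≤ N, ∀ h z, τ h = π (x ^ m * z) → X ^ m ∣ h := by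
    intro m
    induction m with
    | zero => simp
    | succ m ih =>
      intro hm h z hz
      obtain ⟨h', rfl⟩ := ih (by omega) h (x * z) (by rw [hz]; ring_nf)
      obtain ⟨q, hq⟩ := hπs (τ h')
      rw [map_mul, map_pow, hτX, ← hq, ← map_pow, ← map_mul, ← sub_eq_zero, ← map_sub, hπ0] at hz
      obtain ⟨b, hb⟩ := (pow_dvd_pow x hm).trans hz
      have h2 : x ∣ q := by
        refine ⟨z + b, ?_⟩
        apply mul_left_cancel₀ (pow_ne_zero m hx.ne_zero)
        linear_combination hb
      rw [pow_succ]
      refine mul_dvd_mul_left _ (X_dvd_iff.2 ?_)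
      rw [← hτ0 h' q hq.symm, hres]
      exact h2
  obtain ⟨y₀, z, hy₀⟩ := hsurj N le_rfl
  rw [map_sub, (hπ0 (x ^ N * z)).2 (dvd_mul_right _ _), sub_zero] at hy₀
  refine ⟨y₀, fun F i w hi hF => ?_⟩
  have h1 : τ (aevalAeval X y₀ F) = π (x ^ i * w) := by
    rw [algHom_aevalAeval, hτX, hy₀, ← algHom_aevalAeval, hF]
  obtain ⟨f, hf⟩ := hker i hi.le _ _ h1
  refine ⟨f, hf, ?_⟩
  obtain ⟨q, hq⟩ := hπs (τ f)
  rw [hf, map_mul, map_pow, hτX, ← hq, ← map_pow, ← map_mul, ← sub_eq_zero, ← map_sub, hπ0] at h1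
  obtain ⟨b, hb⟩ := (pow_dvd_pow x (Nat.succ_le_of_lt hi)).trans h1
  have h2 : x ∣ q - w := by
    refine ⟨b, ?_⟩
    apply mul_left_cancel₀ (pow_ne_zero i hx.ne_zero)
    rw [mul_sub, hb, pow_succ, mul_assoc]
  rw [← hres, map_sub, sub_eq_zero] at h2
  rw [← h2, ← hτ0 f q hq.symm]

end Approximation

/-- `t`-adic completeness of a module, phrased through expansions in powers of `t`. -/
structure IsPowComplete {R : Type*} (M : Type*) [CommRing R] [AddCommGroup M] [Module R M]
    (t : R) : Prop where
  exists_limit : ∀ a : ℕ → M, ∃ l, ∀ n, ∃ b, l = ∑ i ∈ Finset.range n, t ^ i • a i + t ^ n • b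
  eq_zero : ∀ m : M, (∀ n, ∃ b, m = t ^ n • b) → m = 0

namespace IsPowComplete

variable {R M N : Type*} [CommRing R] [AddCommGroup M] [Module R M] [AddCommGroup N] [Module R N]
  {t : R}

lemma powerSeries (A : Type*) [CommRing A] : IsPowComplete (PowerSeries A) (PowerSeries.X (R := A)) where
  exists_limit a := by
    refine ⟨PowerSeries.mk fun n => ∑ i ∈ Finset.range (n + 1),
      PowerSeries.coeff n (PowerSeries.X ^ i * a i), fun n => ?_⟩
    have : (PowerSeries.X : PowerSeries A) ^ n ∣ (PowerSeries.mk fun n =>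
        ∑ i ∈ Finset.range (n + 1), PowerSeries.coeff n (PowerSeries.X ^ i * a i)) -
          ∑ i ∈ Finset.range n, (PowerSeries.X : PowerSeries A) ^ i • a i := by
      rw [PowerSeries.X_pow_dvd_iff]
      intro m hm
      simp only [map_sub, PowerSeries.coeff_mk, map_sum, smul_eq_mul]
      rw [sub_eq_zero]
      refine Finset.sum_subset (Finset.range_subset_range.2 hm) fun i _ hi => ?_
      rw [PowerSeries.coeff_X_pow_mul', if_neg]
      rw [Finset.mem_range] at hi
      omega
    obtain ⟨b, hb⟩ := this
    exact ⟨b, by rw [smul_eq_mul, ← hb]; ring⟩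
  eq_zero m hm := by
    ext n
    obtain ⟨b, rfl⟩ := hm (n + 1)
    rw [smul_eq_mul, PowerSeries.coeff_X_pow_mul', if_neg (by omega), map_zero]

lemma pi (ι : Type*) (h : IsPowComplete M t) : IsPowComplete (ι → M) t where
  exists_limit a := by
    choose l hl using fun j => h.exists_limit fun i => a i j
    choose b hb using hl
    refine ⟨l, fun n => ⟨fun j => b j n, ?_⟩⟩
    ext j
    simp [hb j n]
  eq_zero m hm := by
    ext j
    refine h.eq_zero _ fun n => ?_
    obtain ⟨b, hb⟩ := hm n
    exact ⟨b j, congrFun hb j⟩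

lemma of_linearEquiv (e : M ≃ₗ[R] N) (h : IsPowComplete M t) : IsPowComplete N t where
  exists_limit a := by
    obtain ⟨l, hl⟩ := h.exists_limit fun i => e.symm (a i)
    refine ⟨e l, fun n => ?_⟩
    obtain ⟨b, hb⟩ := hl n
    exact ⟨e b, by rw [hb]; simp⟩
  eq_zero m hm := by
    rw [← e.symm.map_eq_zero_iff]
    refine h.eq_zero _ fun n => ?_
    obtain ⟨b, hb⟩ := hm n
    exact ⟨e.symm b, by rw [hb]; simp⟩

lemma of_free [Module.Finite R M] [Module.Free R M] (h : IsPowComplete R t) : IsPowComplete M t :=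
  (h.pi _).of_linearEquiv (Module.Free.chooseBasis R M).equivFun.symm

lemma powerSeries_of {A : Type*} [CommRing A] [Algebra R A] (h : IsPowComplete A t) :
    IsPowComplete (PowerSeries A) t :=
  (h.pi ℕ).of_linearEquiv
    { toFun := PowerSeries.mk
      invFun := fun f n => PowerSeries.coeff n f
      map_add' := fun _ _ => rfl
      map_smul' := fun _ _ => rfl
      left_inv := fun f => by ext; simp
      right_inv := fun f => by ext; simp }

lemma exists_eq_smul_eval {S : Type*} [CommRing S] [Algebra R S] (h : IsPowComplete S t)
    (Γ : S[X]) : ∃ η, η = t • Γ.eval η := by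
  have hlip : ∀ x y b : S, ∀ n : ℕ, x - y = t ^ n • b → ∃ b', Γ.eval x - Γ.eval y = t ^ n • b' := by
    intro x y b n hb
    obtain ⟨c, hc⟩ := Polynomial.sub_dvd_eval_sub x y Γ
    exact ⟨b * c, by rw [hc, hb, smul_mul_assoc]⟩
  let a : ℕ → S := fun n => Nat.rec 0 (fun _ y => t • Γ.eval y) n
  have ha : ∀ n, a (n + 1) = t • Γ.eval (a n) := fun n => rfl
  have hd : ∀ n, ∃ d, a (n + 1) - a n = t ^ (n + 1) • d := by
    intro n
    induction n with
    | zero => exact ⟨Γ.eval 0, by simp [a]⟩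
    | succ n ih =>
      obtain ⟨d, hd⟩ := ih
      obtain ⟨b, hb⟩ := hlip _ _ _ _ hd
      exact ⟨b, by rw [ha (n + 1), ha n, ← smul_sub, hb, smul_smul, ← pow_succ']⟩
  choose d hd using hd
  obtain ⟨l, hl⟩ := h.exists_limit fun i => t • d i
  have hsum : ∀ n, ∑ i ∈ Finset.range n, t ^ i • t • d i = a n := by
    intro n
    rw [← sub_zero (a n), ← show a 0 = 0 from rfl, ← Finset.sum_range_sub]
    refine Finset.sum_congr rfl fun i _ => ?_
    rw [hd, smul_smul, pow_succ]
  refine ⟨l, sub_eq_zero.1 (h.eq_zero _ fun n => ?_)⟩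
  obtain ⟨b, hb⟩ := hl n
  rw [hsum] at hb
  obtain ⟨b', hb'⟩ := hlip l (a n) b n (by rw [hb]; ring)
  refine ⟨b - t • (d n + b'), ?_⟩
  have h1 := hd n
  rw [ha] at h1
  simp only [Algebra.smul_def, map_pow] at *
  linear_combination hb - h1 - algebraMap R S t * hb'

lemma exists_pow_eq {S : Type*} [CommRing S] [Algebra R S] [Nontrivial S] (h : IsPowComplete S t) {p : ℕ}
    (hp : IsUnit (p : R)) (s : S) : ∃ r ≠ 0, r ^ p = 1 + t • s := by
  obtain ⟨q, hq⟩ := Polynomial.powAddExpansion (1 : S[X]) X p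
  obtain ⟨p', hpp⟩ := hp.exists_right_inv
  have hpS : (p : S) * algebraMap R S p' = 1 := by
    rw [← map_natCast (algebraMap R S), ← map_mul, hpp, map_one]
  set s' := algebraMap R S p' * s with hs'
  obtain ⟨η, hη⟩ := h.exists_eq_smul_eval
    (C (-algebraMap R S p') * (C s' + X) ^ 2 * q.comp (C (algebraMap R S t) * (C s' + X)))
  have h1 := congrArg (Polynomial.eval (algebraMap R S t * (s' + η))) hq
  simp only [eval_mul, eval_pow, eval_add, eval_C, eval_X, eval_comp, eval_one, one_pow,
    eval_natCast, mul_one, Algebra.smul_def] at hη h1 ⊢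
  have h2 : (1 + algebraMap R S t * (s' + η)) ^ p = 1 + algebraMap R S t * s := by
    rw [h1, mul_pow]
    linear_combination (p : S) * algebraMap R S t * hη + (p : S) * algebraMap R S t * hs' +
      (algebraMap R S t * s - algebraMap R S t ^ 2 * (s' + η) ^ 2 *
        q.eval (algebraMap R S t * (s' + η))) * hpS
  refine ⟨_, fun h0 => ?_, h2⟩
  refine one_ne_zero (h.eq_zero 1 fun n => ⟨(-(s' + η)) ^ n, ?_⟩)
  rw [Algebra.smul_def, map_pow, ← mul_pow, mul_neg, neg_eq_of_add_eq_zero_left h0, one_pow]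

end IsPowComplete

section Specialization

variable {R k κ : Type*} [CommRing R] [Field k] [Field κ] [Algebra R k] [Algebra k κ] [Algebra R κ]
  [IsScalarTower R k κ] [IsFractionRing R k]

lemma exists_isIntegral_pow_smul [IsDomain R] [Algebra.IsAlgebraic k κ] {t : R} (ht : ∀ r ≠ 0, ∃ m, r ∣ t ^ m) (a : κ) :
    ∃ m, IsIntegral R (t ^ m • a) := by
  have h1 : Algebra.IsAlgebraic R k := IsLocalization.isAlgebraic k (nonZeroDivisors R)
  have h2 : IsAlgebraic R a := (IsFractionRing.isAlgebraic_iff R k κ).2 (Algebra.IsAlgebraic.isAlgebraic a)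
  obtain ⟨r, hr0, hr⟩ := h2.exists_integral_multiple
  obtain ⟨m, s, hs⟩ := ht r hr0
  exact ⟨m, by rw [hs, mul_comm, mul_smul]; exact hr.smul s⟩

lemma exists_map_integralClosure_eq [IsDomain R] [Algebra.IsAlgebraic k κ] {t : R} (ht : ∀ r ≠ 0, ∃ m, r ∣ t ^ m)
    (G : κ[X][X]) : ∃ m, ∀ n, m ≤ n → ∃ G' : (integralClosure R κ)[X][X],
      G'.map (mapRingHom (algebraMap (integralClosure R κ) κ)) = C (C (algebraMap R κ t ^ n)) * G := by
  let θ := mapRingHom (mapRingHom (algebraMap (integralClosure R κ) κ))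
  have key : ∃ m G', θ G' = C (C (algebraMap R κ t ^ m)) * G := by
    have hθC : ∀ a, θ (C (C a)) = C (C (a : κ)) := fun a => by
      simp [θ]
    have hmul : ∀ G₁ G₂ : κ[X][X], (∃ m G', θ G' = C (C (algebraMap R κ t ^ m)) * G₁) →
        (∃ m G', θ G' = C (C (algebraMap R κ t ^ m)) * G₂) →
        (∃ m G', θ G' = C (C (algebraMap R κ t ^ m)) * (G₁ * G₂)) := by
      rintro G₁ G₂ ⟨m₁, G₁', h₁⟩ ⟨m₂, G₂', h₂⟩
      exact ⟨m₁ + m₂, G₁' * G₂', by rw [map_mul, h₁, h₂]; simp only [pow_add, C_mul]; ring⟩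
    have hadd : ∀ G₁ G₂ : κ[X][X], (∃ m G', θ G' = C (C (algebraMap R κ t ^ m)) * G₁) →
        (∃ m G', θ G' = C (C (algebraMap R κ t ^ m)) * G₂) →
        (∃ m G', θ G' = C (C (algebraMap R κ t ^ m)) * (G₁ + G₂)) := by
      rintro G₁ G₂ ⟨m₁, G₁', h₁⟩ ⟨m₂, G₂', h₂⟩
      refine ⟨m₁ + m₂, C (C (algebraMap R _ t ^ m₂)) * G₁' + C (C (algebraMap R _ t ^ m₁)) * G₂', ?_⟩
      rw [map_add, map_mul, map_mul, h₁, h₂, hθC, hθC]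
      simp only [pow_add, C_mul, Subalgebra.coe_pow, Subalgebra.coe_algebraMap]
      ring
    induction G using Polynomial.induction_on' with
    | add p q hp hq => exact hadd p q hp hq
    | monomial n a =>
      rw [← C_mul_X_pow_eq_monomial]
      refine hmul _ _ ?_ ⟨0, X ^ n, by simp [θ]⟩
      induction a using Polynomial.induction_on' with
      | add p q hp hq => rw [C_add]; exact hadd _ _ hp hq
      | monomial n a =>
        rw [← C_mul_X_pow_eq_monomial, C_mul]
        refine hmul _ _ ?_ ⟨0, C (X ^ n), by simp [θ]⟩
        obtain ⟨m, hm⟩ := exists_isIntegral_pow_smul (k := k) ht a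
        refine ⟨m, C (C ⟨_, hm⟩), ?_⟩
        rw [hθC, ← C_mul, ← C_mul, ← map_pow, ← Algebra.smul_def]
  obtain ⟨m, G', h⟩ := key
  refine ⟨m, fun n hn => ⟨C (C (algebraMap R _ t ^ (n - m))) * G', ?_⟩⟩
  change θ _ = _
  rw [map_mul, h, ← mul_assoc]
  congr 1
  simp only [θ, coe_mapRingHom, map_C, map_pow]
  rw [← IsScalarTower.algebraMap_apply, ← pow_add, Nat.sub_add_cancel hn]

lemma exists_specialization [IsDomain R] [IsPrincipalIdealRing R] [FiniteDimensional k κ]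
    [Algebra.IsSeparable k κ] {t : R} (hc : IsPowComplete R t) (ht : ∀ r ≠ 0, ∃ m, r ∣ t ^ m)
    {p : ℕ} (hp : IsUnit (p : R)) (G U : κ[X][X]) : ∃ m, ∀ c : κ, IsIntegral R c →
      ∃ η : PowerSeries κ, ∃ r ≠ 0, ∀ ξ, ξ = PowerSeries.C (t ^ m • c) * (1 + PowerSeries.X) →
        η = ξ * aevalAeval ξ η G ∧
        r ^ p = PowerSeries.constantCoeff (1 + ξ * aevalAeval ξ η U) := by
  obtain ⟨m₁, hm₁⟩ := exists_map_integralClosure_eq (k := k) ht G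
  obtain ⟨m₂, hm₂⟩ := exists_map_integralClosure_eq (k := k) ht U
  obtain ⟨G', hG⟩ := hm₁ (m₁ + m₂) (by omega)
  obtain ⟨U', hU⟩ := hm₂ (m₁ + m₂) (by omega)
  set m := m₁ + m₂
  let A := integralClosure R κ
  have : Module.Finite R A := IsIntegralClosure.finite R k κ A
  have : FaithfulSMul R κ := by
    rw [faithfulSMul_iff_algebraMap_injective, IsScalarTower.algebraMap_eq R k κ]
    exact (algebraMap k κ).injective.comp (IsFractionRing.injective R k)
  have : Module.Free R A := IsIntegralClosure.module_free R k κ A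
  have hA : IsPowComplete A t := hc.of_free
  have hS : IsPowComplete (PowerSeries A) t := hA.powerSeries_of
  refine ⟨m + 1, fun c hcI => ?_⟩
  let ζ : PowerSeries A := PowerSeries.C ⟨c, hcI⟩ * (1 + PowerSeries.X)
  let ξ' : PowerSeries A := algebraMap R _ (t ^ (m + 1)) * ζ
  obtain ⟨η, hη⟩ := hS.exists_eq_smul_eval (C ζ * G'.map (aeval ξ').toRingHom)
  obtain ⟨r, hr0, hr⟩ := hA.exists_pow_eq hp
    (PowerSeries.constantCoeff (ζ * (U'.map (aeval ξ').toRingHom).eval η))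
  let ι : PowerSeries A →+* PowerSeries κ := PowerSeries.map (algebraMap A κ)
  have hιR : ∀ a : R, ι (algebraMap R _ a) = PowerSeries.C (algebraMap R κ a) := fun a => by
    rw [IsScalarTower.algebraMap_apply R A (PowerSeries A)]
    simp only [ι]
    erw [PowerSeries.map_C]
    rfl
  have hmap : ∀ (H : κ[X][X]) (H' : A[X][X]),
      H'.map (mapRingHom (algebraMap A κ)) = C (C (algebraMap R κ t ^ m)) * H →
      ι ((H'.map (aeval ξ').toRingHom).eval η) =
        PowerSeries.C (algebraMap R κ t ^ m) * aevalAeval (ι ξ') (ι η) H := by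
    intro H H' hH
    have h1 : aevalAeval (ι ξ') (ι η) (H'.map (mapRingHom (algebraMap A κ))) =
        ι ((H'.map (aeval ξ').toRingHom).eval η) := by
      let f₁ : A[X][X] →+* PowerSeries κ := ((aevalAeval (ι ξ') (ι η) : κ[X][X] →ₐ[κ] PowerSeries κ) : κ[X][X] →+* _).comp
        (mapRingHom (mapRingHom (algebraMap A κ)))
      let f₂ : A[X][X] →+* PowerSeries κ := ι.comp ((evalRingHom η).comp (mapRingHom (aeval ξ').toRingHom))
      have : f₁ = f₂ := by
        ext : 2
        · ext a
          simp [f₁, f₂, ι]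
        · simp [f₁, f₂]
        · simp [f₁, f₂]
      exact DFunLike.congr_fun this H'
    rw [← h1, hH, map_mul]
    congr 1
    simp
  refine ⟨ι η, algebraMap A κ r, ?_, ?_⟩
  · simpa using hr0
  rintro ξ hξ
  have hξ' : ι ξ' = ξ := by
    rw [hξ]
    simp only [ξ', ζ, map_mul, hιR, map_add, map_one, ι, PowerSeries.map_X, PowerSeries.map_C,
      Algebra.smul_def]
    rw [mul_assoc]
    rfl
  have hξζ : PowerSeries.C (algebraMap R κ t) * PowerSeries.C (algebraMap R κ t ^ m) * ι ζ = ξ := by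
    rw [← hξ']
    simp only [ξ', map_mul, hιR, pow_succ, map_pow]
    ring
  constructor
  · have h1 := congrArg ι hη
    rw [Algebra.smul_def, eval_mul, eval_C, map_mul, map_mul, hιR, hmap G G' hG, hξ'] at h1
    linear_combination h1 + aevalAeval ξ (ι η) G * hξζ
  · rw [← map_pow, hr, map_add, map_one, map_add, map_one, Algebra.smul_def, map_mul,
      ← IsScalarTower.algebraMap_apply]
    have h2 : algebraMap A κ (PowerSeries.constantCoeff
        (ζ * (U'.map (aeval ξ').toRingHom).eval η)) =
        PowerSeries.constantCoeff (ι (ζ * (U'.map (aeval ξ').toRingHom).eval η)) := by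
      simp only [← PowerSeries.coeff_zero_eq_constantCoeff_apply, ι, PowerSeries.coeff_map]
    rw [h2, map_mul ι, hmap U U' hU, hξ', ← PowerSeries.constantCoeff_C (algebraMap R κ t), ← map_mul]
    congr 2
    rw [PowerSeries.constantCoeff_C]
    linear_combination aevalAeval ξ (ι η) U * hξζ

end Specialization

section Substitution

lemma Polynomial.aevalAeval_eq_eval {k A : Type*} [CommRing k] [CommRing A] [Algebra k A] (x y : A)
    (F : k[X][X]) : aevalAeval x y F = (F.map (aeval x).toRingHom).eval y := by
  let f : k[X][X] →ₐ[k] A :=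
    { toRingHom := (evalRingHom y).comp (mapRingHom (aeval x).toRingHom)
      commutes' := fun a => by simp [Polynomial.algebraMap_apply] }
  have : aevalAeval x y = f := by
    apply Polynomial.algHom_ext'
    · ext; simp [f]
    · simp [f]
  exact DFunLike.congr_fun this F

/-- A Newton-type change of variables: near an approximate root `y₀` of `F`, the equation `F = 0`
becomes a fixed-point equation, and a polynomial function `P` becomes its leading term times a
`1`-unit. -/
lemma exists_fixedPoint_equation {k κ : Type*} [Field k] [Field κ] [Algebra k κ] (F P : k[X][X])
    (y₀ a d u : κ[X]) (e q m : ℕ) (hF : aevalAeval X y₀ F = X ^ (2 * e + q + 2 + m) * a)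
    (hd : aevalAeval X y₀ (derivative F) = X ^ e * d) (hd0 : d.coeff 0 ≠ 0)
    (hP : aevalAeval X y₀ P = X ^ q * u) (hu0 : u.coeff 0 ≠ 0) :
    ∃ G U : κ[X][X], ∀ (S : Type*) [CommRing S] [Algebra k S] [Algebra κ S]
      [IsScalarTower k κ S] (ξ η : S), η = ξ * aevalAeval ξ η G →
      aevalAeval ξ (aeval ξ y₀ + ξ ^ (e + q + 1) * η) F = 0 ∧
      aevalAeval ξ (aeval ξ y₀ + ξ ^ (e + q + 1) * η) P =
        ξ ^ q * algebraMap κ S (u.coeff 0) * (1 + ξ * aevalAeval ξ η U) := by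
  have hC : ∀ Q : k[X][X], aevalAeval (C X) (C y₀) Q = C (aevalAeval X y₀ Q) := fun Q =>
    (algHom_aevalAeval (CAlgHom : κ[X] →ₐ[k] κ[X][X]) X y₀ Q).symm
  obtain ⟨H, hH⟩ := binomExpansion (F.map (aeval (C X : κ[X][X])).toRingHom) (C y₀)
    (C X ^ (e + q + 1) * X)
  obtain ⟨H', hH'⟩ := sub_dvd_eval_sub (C y₀ + C X ^ (e + q + 1) * X) (C y₀)
    (P.map (aeval (C X : κ[X][X])).toRingHom)
  rw [derivative_map, ← aevalAeval_eq_eval, ← aevalAeval_eq_eval, ← aevalAeval_eq_eval, hC, hC, hF,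
    hd] at hH
  rw [← aevalAeval_eq_eval, ← aevalAeval_eq_eval, hC, hP] at hH'
  refine ⟨-C (C (d.coeff 0)⁻¹) * (C X ^ m * C a + C d.divX * X + C X ^ q * X ^ 2 * H),
    C (C (u.coeff 0)⁻¹) * (C u.divX + C X ^ e * X * H'), ?_⟩
  intro S _ _ _ _ ξ η hη
  let θ : κ[X][X] →ₐ[κ] S := aevalAeval ξ η
  have hθC : ∀ b : κ[X], θ (C b) = aeval ξ b := fun b => by simp [θ]
  have hθX : θ X = η := by simp [θ]
  have hθ : ∀ Q : k[X][X], θ (aevalAeval (C X) (C y₀ + C X ^ (e + q + 1) * X) Q) =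
      aevalAeval ξ (aeval ξ y₀ + ξ ^ (e + q + 1) * η) Q := by
    intro Q
    refine (algHom_aevalAeval (θ.restrictScalars k) _ _ Q).trans ?_
    simp only [AlgHom.restrictScalars_apply, map_add, map_mul, map_pow, hθC, hθX, aeval_X]
  have hdX : aeval ξ d = aeval ξ d.divX * ξ + algebraMap κ S (d.coeff 0) := by
    conv_lhs => rw [← divX_mul_X_add d]
    simp
  have huX : aeval ξ u = aeval ξ u.divX * ξ + algebraMap κ S (u.coeff 0) := by
    conv_lhs => rw [← divX_mul_X_add u]
    simp
  have hdi : algebraMap κ S (d.coeff 0) * algebraMap κ S (d.coeff 0)⁻¹ = 1 := by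
    rw [← map_mul, mul_inv_cancel₀ hd0, map_one]
  have hui : algebraMap κ S (u.coeff 0) * algebraMap κ S (u.coeff 0)⁻¹ = 1 := by
    rw [← map_mul, mul_inv_cancel₀ hu0, map_one]
  have hη' : η = ξ * θ _ := hη
  constructor
  · rw [← hθ, hH]
    simp only [map_add, map_mul, map_pow, map_neg, hθC, hθX, aeval_X, aeval_C] at hη' ⊢
    rw [hdX]
    linear_combination ξ ^ (2 * e + q + 1) * (algebraMap κ S (d.coeff 0) * hη' -
      ξ * (ξ ^ m * aeval ξ a + aeval ξ d.divX * η + ξ ^ q * η ^ 2 * θ H) * hdi)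
  · rw [← hθ, sub_eq_iff_eq_add.1 hH']
    change _ = ξ ^ q * algebraMap κ S (u.coeff 0) * (1 + ξ * θ _)
    simp only [map_add, map_mul, map_pow, map_sub, hθC, hθX, aeval_X, aeval_C]
    rw [huX]
    linear_combination - ξ ^ (q + 1) * (aeval ξ u.divX + ξ ^ e * η * θ H') * hui

end Substitution

section Presentation

lemma aeval_map_eq_aevalAeval {k A : Type u} [Field k] [Field A] [Algebra k A]
    [Algebra (RatFunc k) A] {x : A} (hx : ∀ p : k[X], algebraMap (RatFunc k) A (algebraMap k[X] _ p) = aeval x p)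
    (y : A) (F : k[X][X]) : aeval y (F.map (algebraMap k[X] (RatFunc k))) = aevalAeval x y F := by
  rw [aevalAeval_eq_eval, aeval_def, eval₂_map, eval_map]
  congr 1
  exact RingHom.ext hx

/-- A one-dimensional function field is generated over the rational function field in any
transcendental `x` by an element `y` of a given valuation ring, satisfying one separable
bivariate equation. -/
lemma exists_bivariate_presentation {k K : Type u} [Field k] [CharZero k] [Field K] [Algebra k K]
    [Algebra.EssFiniteType k K] (htr : Algebra.trdeg k K ≤ 1) {x : K} (hx : Transcendental k x)
    (v : ValuationSubring K) : ∃ y ∈ v, ∃ F : k[X][X],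
      aevalAeval x y F = 0 ∧ aevalAeval x y (derivative F) ≠ 0 ∧
      (∀ z : K, ∃ Q : k[X], Q ≠ 0 ∧ ∃ P : k[X][X], aeval x Q * z = aevalAeval x y P) ∧
      ∀ (S : Type u) [Field S] [Algebra k S] (ξ η : S), Transcendental k ξ →
        aevalAeval ξ η F = 0 → ∃ φ : K →ₐ[k] S, φ x = ξ ∧ φ y = η := by
  let := (RatFunc.liftTranscendental hx).toRingHom.toAlgebra
  have : IsScalarTower k (RatFunc k) K := .of_algebraMap_eq fun a =>
    ((RatFunc.liftTranscendental hx).commutes a).symm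
  have hfd : FiniteDimensional (RatFunc k) K := finiteDimensional_of_trdeg_le_one k _ K htr
  have hxK : ∀ p : k[X], algebraMap (RatFunc k) K (algebraMap k[X] _ p) = aeval x p :=
    RatFunc.liftTranscendental_algebraMap hx
  have : CharZero (RatFunc k) := charZero_of_injective_algebraMap (algebraMap k (RatFunc k)).injective
  obtain ⟨y, hy, hgen⟩ : ∃ y ∈ v, IntermediateField.adjoin (RatFunc k) {y} = ⊤ := by
    obtain ⟨y, hy⟩ := Field.exists_primitive_element (RatFunc k) K
    rcases v.mem_or_inv_mem y with h | h
    · exact ⟨y, h, hy⟩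
    · refine ⟨y⁻¹, h, ?_⟩
      rw [eq_top_iff, ← hy, IntermediateField.adjoin_simple_le_iff]
      simpa using inv_mem (IntermediateField.mem_adjoin_simple_self (RatFunc k) y⁻¹)
  have hint : IsIntegral (RatFunc k) y := Algebra.IsIntegral.isIntegral y
  have hadj : Algebra.adjoin (RatFunc k) {y} = ⊤ := by
    rw [← IntermediateField.adjoin_simple_toSubalgebra_of_isAlgebraic hint.isAlgebraic, hgen]
    rfl
  have hclear : ∀ r : (RatFunc k)[X], ∃ Q : k[X], Q ≠ 0 ∧ ∃ P : k[X][X],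
      P.map (algebraMap k[X] (RatFunc k)) = C (algebraMap k[X] (RatFunc k) Q) * r := by
    intro r
    obtain ⟨Q, hQ, h⟩ := IsLocalization.integerNormalization_spec (nonZeroDivisors k[X]) r
    refine ⟨Q, nonZeroDivisors.ne_zero hQ, _, h.trans ?_⟩
    rw [Algebra.smul_def]
    rfl
  obtain ⟨Q₀, hQ₀, F, hF⟩ := hclear (minpoly (RatFunc k) y)
  have hQ₀K : aeval x Q₀ ≠ 0 := fun h => hQ₀ (transcendental_iff.1 hx _ h)
  refine ⟨y, hy, F, ?_, ?_, ?_, ?_⟩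
  · rw [← aeval_map_eq_aevalAeval hxK, hF, map_mul, minpoly.aeval, mul_zero]
  · rw [← aeval_map_eq_aevalAeval hxK, ← derivative_map, hF, derivative_C_mul, map_mul, aeval_C, hxK]
    refine mul_ne_zero hQ₀K ?_
    exact (Algebra.IsSeparable.isSeparable (RatFunc k) y).aeval_derivative_ne_zero (minpoly.aeval _ _)
  · intro z
    have hz : z ∈ Algebra.adjoin (RatFunc k) {y} := by rw [hadj]; trivial
    rw [Algebra.adjoin_singleton_eq_range_aeval] at hz
    obtain ⟨r, rfl⟩ := hz
    obtain ⟨Q, hQ, P, hP⟩ := hclear r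
    refine ⟨Q, hQ, P, ?_⟩
    rw [← aeval_map_eq_aevalAeval hxK, hP, map_mul, aeval_C, hxK]
    rfl
  · intro S _ _ ξ η hξ hη
    let := (RatFunc.liftTranscendental hξ).toRingHom.toAlgebra
    have : IsScalarTower k (RatFunc k) S := .of_algebraMap_eq fun a =>
      ((RatFunc.liftTranscendental hξ).commutes a).symm
    have hξS : ∀ p : k[X], algebraMap (RatFunc k) S (algebraMap k[X] _ p) = aeval ξ p :=
      RatFunc.liftTranscendental_algebraMap hξ
    have hQ₀S : aeval ξ Q₀ ≠ 0 := fun h => hQ₀ (transcendental_iff.1 hξ _ h)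
    rw [← aeval_map_eq_aevalAeval hξS, hF, map_mul, aeval_C, hξS] at hη
    have hη' := (mul_eq_zero.1 hη).resolve_left hQ₀S
    let pb := PowerBasis.ofAdjoinEqTop hint hadj
    have hpb : pb.gen = y := PowerBasis.ofAdjoinEqTop_gen hint hadj
    let φ := pb.lift η (by rwa [hpb])
    refine ⟨φ.restrictScalars k, ?_, ?_⟩
    · have h1 := φ.commutes (algebraMap k[X] _ X)
      rw [hξS, hxK, aeval_X, aeval_X] at h1
      exact h1
    · exact (congrArg φ hpb.symm).trans (pb.lift_gen η _)

end Presentation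

section NotPow

/-- A finite extension of `ℂ((t))` contains an element which is not a `p`-th power. -/
lemma LaurentSeries.exists_ne_pow (κ : Type*) [Field κ] [Algebra (LaurentSeries ℂ) κ]
    [FiniteDimensional (LaurentSeries ℂ) κ] {p : ℕ} (hp : 2 ≤ p) :
    ∃ b : κ, b ≠ 0 ∧ ∀ r : κ, r ^ p ≠ b := by
  by_contra! hcon
  have hpow : ∀ j : ℕ, ∀ b : κ, b ≠ 0 → ∃ r : κ, r ^ (p ^ j) = b := by
    intro j
    induction j with
    | zero => exact fun b _ => ⟨b, by simp⟩
    | succ j ih =>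
      intro b hb
      obtain ⟨r, hr⟩ := ih b hb
      obtain ⟨s, hs⟩ := hcon r (by rintro rfl; exact hb (by rw [← hr, zero_pow (by positivity)]))
      exact ⟨s, by rw [pow_succ', pow_mul, hs, hr]⟩
  set d := Module.finrank (LaurentSeries ℂ) κ with hd
  have hd0 : 0 < d := Module.finrank_pos
  let τ : LaurentSeries ℂ := HahnSeries.single 1 1
  have hτ0 : τ ≠ 0 := HahnSeries.single_ne_zero one_ne_zero
  obtain ⟨r, hr⟩ := hpow d (algebraMap _ κ τ) (by simpa using hτ0)
  have h1 := congrArg (Algebra.norm (LaurentSeries ℂ)) hr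
  rw [map_pow, Algebra.norm_algebraMap, ← hd] at h1
  have h2 := congrArg HahnSeries.order h1
  rw [HahnSeries.order_pow, HahnSeries.order_pow, HahnSeries.order_single one_ne_zero] at h2
  have h3 : ((p ^ d : ℕ) : ℤ) ∣ (d : ℤ) := ⟨_, by simpa using h2.symm⟩
  have h4 := Nat.le_of_dvd hd0 (Int.natCast_dvd_natCast.1 h3)
  exact absurd h4 (not_le.2 (Nat.lt_pow_self hp))

lemma exists_forall_pow_ne {κ : Type*} [Field κ] {p : ℕ} (hp : p.Prime)
    (hκ : ∃ b : κ, b ≠ 0 ∧ ∀ r : κ, r ^ p ≠ b) {u : κ} (hu : u ≠ 0) (q : ℕ)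
    (h : p ∣ q → ∀ r : κ, r ^ p ≠ u) : ∃ b : κ, b ≠ 0 ∧ ∀ r : κ, r ^ p ≠ b ^ q * u := by
  by_cases hup : ∀ r : κ, r ^ p ≠ u
  · exact ⟨1, one_ne_zero, by simpa using hup⟩
  push Not at hup
  obtain ⟨s, rfl⟩ := hup
  have hs : s ≠ 0 := by rintro rfl; exact hu (zero_pow hp.ne_zero)
  have hq : ¬ p ∣ q := fun hq => h hq s rfl
  obtain ⟨b, hb, hbp⟩ := hκ
  refine ⟨b, hb, fun r hr => ?_⟩
  obtain ⟨m, n, hmn⟩ := (Nat.isCoprime_iff_coprime.2 ((Nat.Prime.coprime_iff_not_dvd hp).2 hq) :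
    IsCoprime (p : ℤ) (q : ℤ))
  refine hbp ((r / s) ^ n * b ^ m) ?_
  have h1 : (r / s) ^ p = b ^ q := by
    rw [div_pow, hr, mul_div_cancel_right₀ _ (pow_ne_zero _ hs)]
  calc ((r / s) ^ n * b ^ m) ^ p = ((r / s) ^ p) ^ n * b ^ (m * p) := by
        rw [mul_pow]
        congr 1
        · rw [← zpow_natCast, ← zpow_natCast, ← zpow_mul, ← zpow_mul, mul_comm]
        · rw [← zpow_natCast, ← zpow_mul]
    _ = b ^ (m * p + n * q) := by
        rw [h1, ← zpow_natCast, ← zpow_mul, ← zpow_add₀ hb]; ring_nf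
    _ = b := by rw [hmn, zpow_one]

end NotPow

section LocalData

open IsLocalRing

/-- Polynomial data describing a one-dimensional function field and an element `g` near a place. -/
lemma exists_local_presentation {k K : Type u} [Field k] [CharZero k] [Field K] [Algebra k K]
    [Algebra.EssFiniteType k K] (htr : Algebra.trdeg k K ≤ 1) (v : ValuationSubring K)
    (hk : ∀ a, algebraMap k K a ∈ v) (hv : v ≠ ⊤) {p : ℕ} (hp : p ≠ 0) {g : K} (hg0 : g ≠ 0)
    (hg : ∀ h, h ≠ 0 → ¬ v.valuation (g / h ^ p - 1) < 1) :
    ∃ (κ : Type u) (_ : Field κ) (_ : Algebra k κ) (_ : FiniteDimensional k κ) (x y : K)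
      (F P : k[X][X]) (Q : k[X]) (y₀ a d u : κ[X]) (e q : ℕ),
      Transcendental k x ∧
      (∀ z : K, ∃ Q : k[X], Q ≠ 0 ∧ ∃ P : k[X][X], aeval x Q * z = aevalAeval x y P) ∧
      (∀ (S : Type u) [Field S] [Algebra k S] (ξ η : S), Transcendental k ξ →
        aevalAeval ξ η F = 0 → ∃ φ : K →ₐ[k] S, φ x = ξ ∧ φ y = η) ∧
      Q ≠ 0 ∧ aeval x Q ^ p * g = aevalAeval x y P ∧
      aevalAeval X y₀ F = X ^ (2 * e + q + 2) * a ∧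
      aevalAeval X y₀ (derivative F) = X ^ e * d ∧ d.coeff 0 ≠ 0 ∧
      aevalAeval X y₀ P = X ^ q * u ∧ u.coeff 0 ≠ 0 ∧
      (p ∣ q → ∀ r, r ^ p ≠ u.coeff 0) := by
  let ι : k →+* v := (algebraMap k K).codRestrict v.toSubring hk
  let := ι.toAlgebra
  have : IsScalarTower k v K := .of_algebraMap_eq fun a => rfl
  have hVf : ¬ IsField v := by
    intro hf
    refine hv (eq_top_iff.2 fun a _ => ?_)
    rcases v.mem_or_inv_mem a with h | h
    · exact h
    · rcases eq_or_ne a 0 with rfl | ha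
      · exact v.zero_mem
      obtain ⟨⟨b, hb⟩, hab⟩ := hf.mul_inv_cancel (a := ⟨a⁻¹, h⟩) (by
        intro h0; exact inv_ne_zero ha (congrArg Subtype.val h0))
      have hab' : a⁻¹ * b = 1 := congrArg Subtype.val hab
      rwa [← inv_inv a, inv_eq_of_mul_eq_one_right hab']
  have : IsDiscreteValuationRing v := isDiscreteValuationRing_of_trdeg_le_one k v K htr hVf
  have hfin : FiniteDimensional k (ResidueField v) := finite_residueField_of_trdeg_le_one k v K htr
  have : Algebra.FormallyEtale k (ResidueField v) := Algebra.FormallyEtale.of_isSeparable k _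
  obtain ⟨x, hx⟩ := IsDiscreteValuationRing.exists_irreducible v
  have hxt : Transcendental k (x : K) := transcendental_of_not_isUnit k v K hx.ne_zero hx.not_isUnit
  obtain ⟨y, hy, F, hF, hF', hgen, hlift⟩ := exists_bivariate_presentation htr hxt v
  obtain ⟨Q, hQ, P₁, hP₁⟩ := hgen g
  have hcoe : ∀ R : k[X][X], ((aevalAeval x (⟨y, hy⟩ : v) R : v) : K) = aevalAeval (x : K) y R :=
    fun R => algHom_aevalAeval (IsScalarTower.toAlgHom k v K) x ⟨y, hy⟩ R
  have hQx : aeval (x : K) Q ≠ 0 := fun h => hQ (transcendental_iff.1 hxt _ h)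
  set P := P₁ * C Q ^ (p - 1) with hPdef
  have hP : aeval (x : K) Q ^ p * g = aevalAeval (x : K) y P := by
    obtain ⟨m, rfl⟩ := Nat.exists_eq_succ_of_ne_zero hp
    rw [hPdef, map_mul, map_pow, aevalAeval_C, ← hP₁, Nat.succ_sub_one, pow_succ]
    ring
  have hP0 : aevalAeval x (⟨y, hy⟩ : v) P ≠ 0 := by
    intro h
    refine mul_ne_zero (pow_ne_zero p hQx) hg0 ?_
    rw [hP, ← hcoe, h]
    rfl
  have hF0 : aevalAeval x (⟨y, hy⟩ : v) (derivative F) ≠ 0 := by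
    intro h
    refine hF' ?_
    rw [← hcoe, h]
    rfl
  obtain ⟨q, w, hw⟩ := IsDiscreteValuationRing.eq_unit_mul_pow_irreducible hP0 hx
  obtain ⟨e, w', hw'⟩ := IsDiscreteValuationRing.eq_unit_mul_pow_irreducible hF0 hx
  obtain ⟨y₀, hy₀⟩ := IsDiscreteValuationRing.exists_polynomial_approx (k := k) hx
    (2 * e + q + 3) (⟨y, hy⟩ : v)
  obtain ⟨a, ha, -⟩ := hy₀ F (2 * e + q + 2) 0 (by omega) (by
    rw [mul_zero]
    exact Subtype.ext ((hcoe F).trans hF))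
  obtain ⟨d, hd, hd0⟩ := hy₀ (derivative F) e w' (by omega) (by rw [hw', mul_comm])
  obtain ⟨u, hu, hu0⟩ := hy₀ P q w (by omega) (by rw [hw, mul_comm])
  have hunit : ∀ w : vˣ, residue v w ≠ 0 := fun w => (w.isUnit.map (residue v)).ne_zero
  refine ⟨ResidueField v, inferInstance, inferInstance, hfin, x, y, F, P, Q, y₀, a, d, u, e, q, hxt,
    hgen, hlift, hQ, hP, ha, hd, by rw [hd0]; exact hunit w', hu, by rw [hu0]; exact hunit w, ?_⟩
  rintro ⟨q', rfl⟩ r hr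
  obtain ⟨s, rfl⟩ := residue_surjective r
  have hs : IsUnit s := by
    rw [← residue_ne_zero_iff_isUnit]
    rintro h0
    rw [h0, zero_pow hp, hu0] at hr
    exact hunit w hr.symm
  have hx0 : (x : K) ≠ 0 := fun h => hx.ne_zero (Subtype.ext h)
  have hs0 : (s : K) ≠ 0 := fun h => hs.ne_zero (Subtype.ext h)
  refine hg ((x : K) ^ q' * s / aeval (x : K) Q) (div_ne_zero (mul_ne_zero (pow_ne_zero _ hx0) hs0) hQx) ?_
  obtain ⟨s, rfl⟩ := hs
  have h1 : g / ((x : K) ^ q' * (s : v) / aeval (x : K) Q) ^ p - 1 =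
      (((w : v) - (s : v) ^ p) * ((s⁻¹ : vˣ) : v) ^ p : v) := by
    have h2 : (((s⁻¹ : vˣ) : v) : K) = ((s : v) : K)⁻¹ := by
      refine (inv_eq_of_mul_eq_one_right ?_).symm
      exact congrArg Subtype.val s.mul_inv
    have h3 : aeval (x : K) Q ^ p * g = (w : v) * (x : K) ^ (p * q') := by
      rw [hP, ← hcoe, hw]
      rfl
    change _ = (((w : v) : K) - ((s : v) : K) ^ p) * (((s⁻¹ : vˣ) : v) : K) ^ p
    rw [h2, inv_pow, sub_mul, mul_inv_cancel₀ (pow_ne_zero _ hs0)]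
    congr 1
    rw [div_pow, mul_pow, ← pow_mul, mul_comm q', div_div_eq_mul_div, mul_comm g, h3]
    field_simp
  rw [h1, ← ValuationSubring.valuation_lt_one_iff]
  refine Ideal.mul_mem_right _ _ ?_
  rw [← residue_eq_zero_iff, map_sub, map_pow, hr, hu0, sub_self]

end LocalData

section PowerSeriesPlace

variable (κ : Type*) [Field κ]

/-- The ring of formal power series as a valuation subring of its fraction field. -/
noncomputable def PowerSeries.valuationSubring : ValuationSubring (FractionRing (PowerSeries κ)) where
  toSubring := (algebraMap (PowerSeries κ) (FractionRing (PowerSeries κ))).range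
  mem_or_inv_mem' := ValuationRing.isInteger_or_isInteger (PowerSeries κ)

variable {κ}

lemma PowerSeries.mem_valuationSubring {z : FractionRing (PowerSeries κ)} :
    z ∈ PowerSeries.valuationSubring κ ↔ ∃ a : PowerSeries κ, algebraMap _ _ a = z := Iff.rfl

lemma PowerSeries.valuation_algebraMap_lt_one_iff (a : PowerSeries κ) :
    (PowerSeries.valuationSubring κ).valuation (algebraMap _ _ a) < 1 ↔
      PowerSeries.constantCoeff a = 0 := by
  rcases eq_or_ne a 0 with rfl | ha
  · simp
  have ha' : algebraMap (PowerSeries κ) (FractionRing (PowerSeries κ)) a ≠ 0 := by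
    rwa [Ne, IsFractionRing.to_map_eq_zero_iff]
  rw [ValuationSubring.valuation_lt_one_iff_inv_notMem _ ha', not_iff_comm, mem_valuationSubring,
    ← Ne, ← isUnit_iff_ne_zero, ← isUnit_iff_constantCoeff]
  constructor
  · intro h
    obtain ⟨b, hb⟩ := h.exists_right_inv
    refine ⟨b, (inv_eq_of_mul_eq_one_right ?_).symm⟩
    rw [← map_mul, hb, map_one]
  · rintro ⟨b, hb⟩
    refine IsUnit.of_mul_eq_one b (IsFractionRing.injective (PowerSeries κ) (FractionRing (PowerSeries κ)) ?_)
    rw [map_mul, hb, map_one, mul_inv_cancel₀ ha']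

lemma constantCoeff_polynomial_aeval {k : Type*} [Field k] [Algebra k κ] (ξ : PowerSeries κ) (Q : k[X]) :
    PowerSeries.constantCoeff (Polynomial.aeval ξ Q) = Polynomial.aeval (PowerSeries.constantCoeff ξ) Q := by
  rw [aeval_def, hom_eval₂, aeval_def]
  congr 1

lemma transcendental_C_mul_one_add_X {k κ : Type u} [Field k] [Field κ] [Algebra k κ]
    [Algebra.IsAlgebraic k κ] {c : κ} (hc : c ≠ 0) :
    Transcendental k (algebraMap (PowerSeries κ) (FractionRing (PowerSeries κ))
      (PowerSeries.C c * (1 + PowerSeries.X))) := by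
  intro h
  have h0 : PowerSeries.C c * PowerSeries.X ≠ 0 :=
    mul_ne_zero (by simpa using hc) PowerSeries.X_ne_zero
  have h1 : ¬ IsUnit (PowerSeries.C c * PowerSeries.X) := by
    simp [PowerSeries.isUnit_iff_constantCoeff]
  have h2 : IsAlgebraic k (algebraMap (PowerSeries κ) (FractionRing (PowerSeries κ)) (PowerSeries.C c)) := by
    have h3 := (Algebra.IsAlgebraic.isAlgebraic (R := k) c).algHom
      ((IsScalarTower.toAlgHom k (PowerSeries κ) (FractionRing (PowerSeries κ))).comp
        (IsScalarTower.toAlgHom k κ (PowerSeries κ)))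
    exact h3
  refine transcendental_of_not_isUnit k (PowerSeries κ) (FractionRing (PowerSeries κ)) h0 h1 ?_
  have h3 := h.sub h2
  rwa [← map_sub, mul_add, mul_one, add_sub_cancel_left] at h3

end PowerSeriesPlace

section Parameter

/-- Scaling by suitable powers of `t` gives parameters avoiding the zeros of a polynomial. -/
lemma LaurentSeries.exists_single_smul_eval_ne_zero {κ : Type*} [Field κ] [Algebra (LaurentSeries ℂ) κ]
    {b : κ} (hb : b ≠ 0) {p : ℕ} (hp : p ≠ 0) (D : (LaurentSeries ℂ)[X]) (hD : D ≠ 0) (M : ℕ) :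
    ∃ j ≥ M, aeval (((PowerSeries.X : PowerSeries ℂ) : LaurentSeries ℂ) ^ (p * j) • b) D ≠ 0 := by
  by_contra! hcon
  have hinj : Function.Injective fun j : ℕ =>
      (((PowerSeries.X : PowerSeries ℂ) : LaurentSeries ℂ) ^ (p * (M + j)) • b) := by
    intro i j hij
    have h1 := smul_left_injective (LaurentSeries ℂ) hb hij
    rw [PowerSeries.coe_X] at h1
    have h2 := congrArg HahnSeries.order h1
    rw [HahnSeries.order_pow, HahnSeries.order_pow, HahnSeries.order_single one_ne_zero] at h2
    have h3 : p * (M + i) = p * (M + j) := by simpa using h2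
    have := Nat.eq_of_mul_eq_mul_left (Nat.pos_of_ne_zero hp) h3
    omega
  refine Set.infinite_range_of_injective hinj ((D.rootSet_finite κ).subset ?_)
  rintro _ ⟨j, rfl⟩
  rw [mem_rootSet]
  exact ⟨hD, hcon _ (by omega)⟩

end Parameter

section Core

/-- A function on a curve over `ℂ((t))` which is not a local `p`-th power at some place is a unit
with residue not a `p`-th power at some place avoiding the zeros of given functions. -/
lemma exists_place_residue_ne_pow {K : Type} [Field K] [Algebra (LaurentSeries ℂ) K]
    [Algebra.EssFiniteType (LaurentSeries ℂ) K] (htr : Algebra.trdeg (LaurentSeries ℂ) K ≤ 1)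
    (v₀ : ValuationSubring K) (hk : ∀ a, algebraMap (LaurentSeries ℂ) K a ∈ v₀) (hv₀ : v₀ ≠ ⊤)
    {p : ℕ} (hp : p.Prime) {g : K} (hg0 : g ≠ 0)
    (hg : ∀ h, h ≠ 0 → ¬ v₀.valuation (g / h ^ p - 1) < 1) (W : Finset K) (hW : ∀ w ∈ W, w ≠ 0) :
    ∃ v : ValuationSubring K, (∀ a, algebraMap (LaurentSeries ℂ) K a ∈ v) ∧ v ≠ ⊤ ∧
      (∀ w ∈ W, ¬ v.valuation w < 1) ∧ v.valuation g = 1 ∧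
      ∀ h, ¬ v.valuation (g - h ^ p) < 1 := by
  have : CharZero (LaurentSeries ℂ) :=
    charZero_of_injective_algebraMap (algebraMap ℂ (LaurentSeries ℂ)).injective
  obtain ⟨κ, _, _, _, x, y, F, P, Q, y₀, a, d, u, e, q, hx, hgen, hlift, hQ, hP, hF, hd, hd0, hu,
    hu0, hpow⟩ := exists_local_presentation htr v₀ hk hv₀ hp.ne_zero hg0 hg
  obtain ⟨b, hb0, hb⟩ := exists_forall_pow_ne hp (LaurentSeries.exists_ne_pow κ hp.two_le) hu0 q hpow
  choose Qz hQz Pz hPz using hgen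
  obtain ⟨G, U, hGU⟩ := exists_fixedPoint_equation F P y₀ a d u e q 0 hF hd hd0 hu hu0
  let : Algebra (PowerSeries ℂ) κ := ((algebraMap (LaurentSeries ℂ) κ).comp
    (algebraMap (PowerSeries ℂ) (LaurentSeries ℂ))).toAlgebra
  have : IsScalarTower (PowerSeries ℂ) (LaurentSeries ℂ) κ := .of_algebraMap_eq fun _ => rfl
  have ht : ∀ r : PowerSeries ℂ, r ≠ 0 → ∃ m, r ∣ PowerSeries.X ^ m := by
    intro r hr
    obtain ⟨m, w, rfl⟩ := IsDiscreteValuationRing.eq_unit_mul_pow_irreducible hr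
      (PowerSeries.X_prime (R := ℂ)).irreducible
    exact ⟨m, by simp⟩
  have hpu : IsUnit (p : PowerSeries ℂ) := by
    rw [PowerSeries.isUnit_iff_constantCoeff]
    simpa using hp.ne_zero
  obtain ⟨m, hm⟩ := exists_specialization (k := LaurentSeries ℂ) (IsPowComplete.powerSeries ℂ) ht hpu G U
  obtain ⟨m', hm'⟩ := exists_isIntegral_pow_smul (k := LaurentSeries ℂ) ht b
  obtain ⟨j, hj, hjD⟩ := LaurentSeries.exists_single_smul_eval_ne_zero hb0 hp.ne_zero
    (Q * ∏ w ∈ W, Qz w⁻¹) (mul_ne_zero hQ (Finset.prod_ne_zero_iff.2 fun w _ => hQz _)) (m + m')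
  set τ : LaurentSeries ℂ := ((PowerSeries.X : PowerSeries ℂ) : LaurentSeries ℂ) with hτ
  have hτ0 : τ ≠ 0 := by
    rw [hτ, PowerSeries.coe_X]
    exact HahnSeries.single_ne_zero one_ne_zero
  have hτs : ∀ i (z : κ), (PowerSeries.X : PowerSeries ℂ) ^ i • z = τ ^ i • z := by
    intro i z
    rw [Algebra.smul_def, Algebra.smul_def]
    change algebraMap (LaurentSeries ℂ) κ (algebraMap (PowerSeries ℂ) (LaurentSeries ℂ) _) * z = _
    rw [map_pow]
    rfl
  set c : κ := τ ^ (p * j) • b with hc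
  have hc0 : c ≠ 0 := smul_ne_zero (pow_ne_zero _ hτ0) hb0
  obtain ⟨l, hl⟩ : ∃ l, p * j = m + (l + m') := by
    have : j ≤ p * j := Nat.le_mul_of_pos_left _ hp.pos
    exact ⟨p * j - (m + m'), by omega⟩
  obtain ⟨η, r, hr0, hηr⟩ := hm _ ((hm'.smul (PowerSeries.X ^ l : PowerSeries ℂ)))
  obtain ⟨hη, hr⟩ := hηr (PowerSeries.C c * (1 + PowerSeries.X)) (by
    rw [smul_smul, smul_smul, ← pow_add, ← pow_add, hτs, add_assoc, ← hl])
  set ξ : PowerSeries κ := PowerSeries.C c * (1 + PowerSeries.X) with hξ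
  have hξc : PowerSeries.constantCoeff ξ = c := by simp [hξ]
  obtain ⟨hYF, hYP⟩ := hGU (PowerSeries κ) ξ η hη
  set Y : PowerSeries κ := aeval ξ y₀ + ξ ^ (e + q + 1) * η
  let ι := IsScalarTower.toAlgHom (LaurentSeries ℂ) (PowerSeries κ) (FractionRing (PowerSeries κ))
  obtain ⟨φ, hφx, hφy⟩ := hlift (FractionRing (PowerSeries κ)) (ι ξ) (ι Y)
    (transcendental_C_mul_one_add_X hc0) (by rw [← algHom_aevalAeval, hYF, map_zero])
  have hφP : ∀ P : (LaurentSeries ℂ)[X][X], φ (aevalAeval x y P) = ι (aevalAeval ξ Y P) := fun P => by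
    rw [algHom_aevalAeval, algHom_aevalAeval, hφx, hφy]
  have hφQ : ∀ Q : (LaurentSeries ℂ)[X], φ (aeval x Q) = ι (aeval ξ Q) := fun Q => by
    rw [← aeval_algHom_apply, ← aeval_algHom_apply, hφx]
  set v := (PowerSeries.valuationSubring κ).comap (φ : K →+* FractionRing (PowerSeries κ)) with hv
  have hmem : ∀ z, z ∈ v ↔ ∃ s : PowerSeries κ, ι s = φ z := fun z => Iff.rfl
  have hlt : ∀ z s, φ z = ι s → (v.valuation z < 1 ↔ PowerSeries.constantCoeff s = 0) := by
    intro z s hz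
    rw [← PowerSeries.valuation_algebraMap_lt_one_iff, hv, ValuationSubring.valuation_comap_lt_one_iff]
    change (PowerSeries.valuationSubring κ).valuation (φ z) < 1 ↔ _
    rw [hz]
    rfl
  have hltQ : ∀ Q : (LaurentSeries ℂ)[X], v.valuation (aeval x Q) < 1 ↔ aeval c Q = 0 := fun Q => by
    rw [hlt _ _ (hφQ Q), constantCoeff_polynomial_aeval, hξc]
  have hQ0 : ∀ Q : (LaurentSeries ℂ)[X], Q ≠ 0 → aeval x Q ≠ 0 :=
    fun Q hQ h => hQ (transcendental_iff.1 hx _ h)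
  rw [map_mul, map_prod] at hjD
  have hcQ : aeval c Q ≠ 0 := left_ne_zero_of_mul hjD
  have hcQz : ∀ w ∈ W, aeval c (Qz w⁻¹) ≠ 0 := fun w hw =>
    Finset.prod_ne_zero_iff.1 (right_ne_zero_of_mul hjD) w hw
  have hinv : ∀ Q : (LaurentSeries ℂ)[X], Q ≠ 0 → aeval c Q ≠ 0 → (aeval x Q)⁻¹ ∈ v := by
    intro Q hQ hcQ
    have h1 := mt (hltQ Q).1 hcQ
    rwa [ValuationSubring.valuation_lt_one_iff_inv_notMem _ (hQ0 Q hQ), not_not] at h1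
  have hPv : ∀ P : (LaurentSeries ℂ)[X][X], aevalAeval x y P ∈ v := fun P =>
    (hmem _).2 ⟨_, (hφP P).symm⟩
  obtain ⟨s, hs⟩ := (hmem _).1 (hinv Q hQ hcQ)
  have hsc : PowerSeries.constantCoeff s * aeval c Q = 1 := by
    have h1 : s * aeval ξ Q = 1 := by
      apply IsFractionRing.injective (PowerSeries κ) (FractionRing (PowerSeries κ))
      change ι (s * aeval ξ Q) = ι 1
      rw [map_mul, hs, ← hφQ, ← map_mul, inv_mul_cancel₀ (hQ0 Q hQ), map_one, map_one]
    have h2 := congrArg PowerSeries.constantCoeff h1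
    rwa [map_mul, constantCoeff_polynomial_aeval, hξc, map_one] at h2
  have hs0 : PowerSeries.constantCoeff s ≠ 0 := left_ne_zero_of_mul_eq_one hsc
  have hφg : φ g = ι (s ^ p * aevalAeval ξ Y P) := by
    rw [map_mul, ← hφP, ← hP, map_pow, hs, ← map_pow, ← map_mul, ← mul_assoc, ← mul_pow,
      inv_mul_cancel₀ (hQ0 Q hQ), one_pow, one_mul]
  have hgc : PowerSeries.constantCoeff (s ^ p * aevalAeval ξ Y P) =
      (PowerSeries.constantCoeff s * r) ^ p * (c ^ q * u.coeff 0) := by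
    rw [hYP, map_mul, map_mul, map_mul, ← hr, map_pow, map_pow, hξc]
    change _ * (_ * PowerSeries.constantCoeff (PowerSeries.C (u.coeff 0)) * _) = _
    rw [PowerSeries.constantCoeff_C]
    ring
  have hgv : g ∈ v := (hmem _).2 ⟨_, hφg.symm⟩
  refine ⟨v, fun a => (hmem _).2 ⟨algebraMap _ _ a, ?_⟩, ?_, ?_, ?_, ?_⟩
  · rw [AlgHom.commutes, AlgHom.commutes]
  · intro htop
    have hint : IsIntegral (LaurentSeries ℂ) c := Algebra.IsIntegral.isIntegral c
    have h1 := (hltQ (minpoly (LaurentSeries ℂ) c)).2 (minpoly.aeval _ _)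
    rw [ValuationSubring.valuation_lt_one_iff_inv_notMem _ (hQ0 _ (minpoly.ne_zero hint)), htop] at h1
    exact h1 trivial
  · intro w hw
    rw [ValuationSubring.valuation_lt_one_iff_inv_notMem _ (hW w hw), not_not,
      (eq_inv_mul_iff_mul_eq₀ (hQ0 _ (hQz w⁻¹))).2 (hPz w⁻¹)]
    exact v.mul_mem _ _ (hinv _ (hQz _) (hcQz w hw)) (hPv _)
  · refine le_antisymm ((v.valuation_le_one_iff g).2 hgv) (not_lt.1 fun h => ?_)
    rw [hlt _ _ hφg, hgc] at h
    exact mul_ne_zero (pow_ne_zero _ (mul_ne_zero hs0 hr0)) (mul_ne_zero (pow_ne_zero _ hc0) hu0) h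
  · intro h hh
    have hhv : h ∈ v := by
      have h1 := sub_mem hgv ((v.valuation_le_one_iff _).1 hh.le)
      rw [sub_sub_cancel, ← v.valuation_le_one_iff, map_pow, pow_le_one_iff hp.ne_zero,
        v.valuation_le_one_iff] at h1
      exact h1
    obtain ⟨z, hz⟩ := (hmem _).1 hhv
    rw [hlt _ (s ^ p * aevalAeval ξ Y P - z ^ p) (by rw [map_sub, map_sub, hφg, map_pow, map_pow, hz]),
      map_sub, hgc, map_pow, sub_eq_zero] at hh
    have hτκ : algebraMap (LaurentSeries ℂ) κ τ ≠ 0 := (_root_.map_ne_zero _).2 hτ0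
    refine hb (PowerSeries.constantCoeff z / (PowerSeries.constantCoeff s * r *
      algebraMap (LaurentSeries ℂ) κ τ ^ (j * q))) ?_
    rw [div_pow, ← hh, hc, Algebra.smul_def, map_pow]
    field_simp
    ring

end Core

section Kummer

/-- If an automorphism of a Kummer extension of prime degree stabilizes one valuation ring, it
stabilizes one at which given functions have no zero. -/
lemma exists_valuationSubring_map_mem {K L : Type} [Field K] [Field L] [Algebra (LaurentSeries ℂ) K]
    [Algebra.EssFiniteType (LaurentSeries ℂ) K] (htr : Algebra.trdeg (LaurentSeries ℂ) K ≤ 1)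
    [Algebra K L] (σ : L ≃ₐ[K] L) {α : L} (hα0 : α ≠ 0) {p : ℕ} (hp : p.Prime) {ω : ℂ} (hω : ω ≠ 1)
    (hσα : σ α = algebraMap K L (algebraMap (LaurentSeries ℂ) K (algebraMap ℂ _ ω)) * α)
    {g : K} (hg : α ^ p = algebraMap K L g) (hgen : Algebra.adjoin K {α} = ⊤)
    (B₀ : ValuationSubring L)
    (hk : ∀ a, algebraMap (LaurentSeries ℂ) K a ∈ B₀.comap (algebraMap K L))
    (hB₀ : B₀.comap (algebraMap K L) ≠ ⊤) (hσ : ∀ y, σ y ∈ B₀ ↔ y ∈ B₀)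
    (W : Finset K) (hW : ∀ w ∈ W, w ≠ 0) :
    ∃ B : ValuationSubring L,
      (∀ a, algebraMap (LaurentSeries ℂ) K a ∈ B.comap (algebraMap K L)) ∧
      B.comap (algebraMap K L) ≠ ⊤ ∧
      (∀ w ∈ W, ¬ (B.comap (algebraMap K L)).valuation w < 1) ∧ ∀ y ∈ B, σ y ∈ B := by
  have hg0 : g ≠ 0 := by
    rintro rfl
    rw [map_zero] at hg
    exact pow_ne_zero p hα0 hg
  obtain ⟨v, hvk, hv, hvW, hvg, hvp⟩ := exists_place_residue_ne_pow htr _ hk hB₀ hp hg0 (by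
    intro h _ hlt
    rw [ValuationSubring.valuation_comap_lt_one_iff, map_sub, map_div₀, map_pow, map_one, ← hg] at hlt
    refine B₀.not_sub_one_lt_one_of_map_eq ((algebraMap K L).comp
      ((algebraMap (LaurentSeries ℂ) K).comp (algebraMap ℂ (LaurentSeries ℂ)))) (fun c => hk _)
      (σ : L →+* L) ?_ (fun c => σ.commutes _) (σ.commutes h) hω hσα hp.pos hlt
    intro a ha
    rcases eq_or_ne a 0 with rfl | ha0
    · simp
    change B₀.valuation (σ a) < 1
    rw [ValuationSubring.valuation_lt_one_iff_inv_notMem _ ha0] at ha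
    rwa [ValuationSubring.valuation_lt_one_iff_inv_notMem _ (by simpa using ha0), ← map_inv₀, hσ]) W hW
  obtain ⟨B, rfl⟩ := ValuationSubring.exists_comap_algebraMap_eq (L := L) v
  refine ⟨B, hvk, hv, hvW, fun y hy => ?_⟩
  have hαB : α ∈ B := by
    rw [← B.valuation_le_one_iff, ← pow_le_one_iff hp.ne_zero, ← map_pow, hg,
      B.valuation_le_one_iff]
    exact (ValuationSubring.valuation_le_one_iff (B.comap (algebraMap K L)) g).1 hvg.le
  have hyadj : y ∈ Algebra.adjoin K {α} := by rw [hgen]; trivial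
  rw [Algebra.adjoin_singleton_eq_range_aeval] at hyadj
  obtain ⟨P₀, rfl⟩ := hyadj
  have hmonic : (X ^ p - C g).Monic := monic_X_pow_sub_C g hp.ne_zero
  have hroot : aeval α (X ^ p - C g) = 0 := by simp [hg]
  change aeval α P₀ ∈ B at hy
  change σ (aeval α P₀) ∈ B
  rw [← aeval_modByMonic_eq_self_of_root hroot] at hy ⊢
  have hcoeff := B.coeff_mem_of_aeval_mem hp hg hvg hvp _
    ((degree_modByMonic_lt P₀ hmonic).trans_eq (degree_X_pow_sub_C hp.pos g)) hy
  rw [aeval_eq_sum_range, map_sum]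
  refine sum_mem fun i _ => ?_
  rw [map_smul, map_pow, hσα, Algebra.smul_def]
  exact B.mul_mem _ _ (hcoeff i) (pow_mem (B.mul_mem _ _ (hvk _) hαB) i)

end Kummer

open scoped Pointwise in
lemma ValuationSubring.mem_decompositionSubgroup_iff {K L : Type*} [Field K] [Field L] [Algebra K L]
    (B : ValuationSubring L) (σ : L ≃ₐ[K] L) :
    σ ∈ B.decompositionSubgroup K ↔ ∀ y, σ y ∈ B ↔ y ∈ B := by
  rw [MulAction.mem_stabilizer_iff]
  constructor
  · intro h y
    conv_lhs => rw [← h]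
    exact ValuationSubring.smul_mem_pointwise_smul_iff
  · intro h
    ext y
    obtain ⟨z, rfl⟩ := σ.surjective y
    rw [h]
    exact ValuationSubring.smul_mem_pointwise_smul_iff

lemma ValuationSubring.mem_decompositionSubgroup_of_isOfFinOrder {K L : Type*} [Field K] [Field L]
    [Algebra K L] (B : ValuationSubring L) {σ : L ≃ₐ[K] L} (hσ : IsOfFinOrder σ)
    (h : ∀ y ∈ B, σ y ∈ B) : σ ∈ B.decompositionSubgroup K := by
  refine (B.mem_decompositionSubgroup_iff σ).2 fun y => ⟨fun hy => ?_, h y⟩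
  have hpow : ∀ i : ℕ, ∀ y ∈ B, (σ ^ i) y ∈ B := by
    intro i
    induction i with
    | zero => exact fun y hy => hy
    | succ i ih => exact fun y hy => by rw [pow_succ]; exact ih _ (h y hy)
  obtain ⟨n, hn, hσn⟩ := isOfFinOrder_iff_pow_eq_one.1 hσ
  have h1 := hpow (n - 1) _ hy
  rwa [← AlgEquiv.mul_apply, ← pow_succ, Nat.sub_add_cancel hn, hσn] at h1

/-- A nontrivial automorphism of finite prime order of a Kummer extension over its fixed field acts
on the generator through a nontrivial constant `p`-th root of unity. -/
lemma exists_complex_map_eq_mul {K L : Type*} [Field K] [Field L] [Algebra K L] (j : ℂ →+* K)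
    {n : ℕ} (hn : 0 < n) {f : K} {α : L} (hα : α ^ n = algebraMap K L f) (hα0 : α ≠ 0)
    (hgen : Algebra.adjoin K {α} = ⊤) {σ : L ≃ₐ[K] L} (hσ : σ ≠ 1) :
    ∃ ω : ℂ, ω ≠ 1 ∧ σ α = algebraMap K L (j ω) * α := by
  have h1 : (σ α / α) ^ n = 1 := by
    rw [div_pow, ← map_pow, hα, σ.commutes, ← hα, div_self (pow_ne_zero _ hα0)]
  have h2 := pow_sub_one_eq_prod_complex ((algebraMap K L).comp j) hn (σ α / α)
  rw [h1, sub_self, eq_comm, Finset.prod_eq_zero_iff] at h2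
  obtain ⟨ω, -, hω⟩ := h2
  have h3 : σ α = algebraMap K L (j ω) * α := by
    rw [← div_eq_iff hα0]
    exact sub_eq_zero.1 hω
  refine ⟨ω, ?_, h3⟩
  rintro rfl
  rw [map_one, map_one, one_mul] at h3
  refine hσ (AlgEquiv.coe_toAlgHom_injective ?_)
  refine AlgHom.ext_of_adjoin_eq_top hgen ?_
  rintro _ rfl
  exact h3

lemma adjoin_singleton_eq_top_of_tower (K : Type*) {K' L : Type*} [Field K] [Field K'] [Field L]
    [Algebra K K'] [Algebra K L] [Algebra K' L] [IsScalarTower K K' L] {α : L}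
    (hgen : Algebra.adjoin K {α} = ⊤) : Algebra.adjoin K' {α} = ⊤ := by
  have h1 : Algebra.adjoin K {α} ≤ (Algebra.adjoin K' {α}).restrictScalars K :=
    Algebra.adjoin_le fun x hx =>
      show x ∈ Algebra.adjoin K' {α} from Algebra.subset_adjoin hx
  rw [hgen] at h1
  exact eq_top_iff.2 fun y _ => h1 (Algebra.mem_top (x := y))

/-- An automorphism over an intermediate field `K'`, acting on a Kummer generator through a
nontrivial `p`-th root of unity and stabilizing one valuation ring, stabilizes one at which given
functions on the base have no zero. -/
lemma exists_valuationSubring_map_mem_of_tower {K K' L : Type} [Field K] [Field K'] [Field L]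
    [Algebra (LaurentSeries ℂ) K] [Algebra (RatFunc (LaurentSeries ℂ)) K]
    [IsScalarTower (LaurentSeries ℂ) (RatFunc (LaurentSeries ℂ)) K]
    [FiniteDimensional (RatFunc (LaurentSeries ℂ)) K] [Algebra K K'] [FiniteDimensional K K']
    [Algebra K L] [Algebra K' L] [IsScalarTower K K' L]
    (σ : L ≃ₐ[K'] L) {α : L} (hα0 : α ≠ 0) {p : ℕ} (hp : p.Prime) {ω : ℂ} (hω : ω ≠ 1)
    (hσα : σ α = algebraMap K L (algebraMap (LaurentSeries ℂ) K (algebraMap ℂ _ ω)) * α)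
    {g : K'} (hg : α ^ p = algebraMap K' L g) (hgen : Algebra.adjoin K {α} = ⊤)
    (B₀ : ValuationSubring L)
    (hk : ∀ a, algebraMap (LaurentSeries ℂ) K a ∈ B₀.comap (algebraMap K L))
    (hB₀ : B₀.comap (algebraMap K L) ≠ ⊤) (hσB : ∀ y, σ y ∈ B₀ ↔ y ∈ B₀)
    (W : Finset K) (hW : ∀ w ∈ W, w ≠ 0) :
    ∃ B : ValuationSubring L,
      (∀ a, algebraMap (LaurentSeries ℂ) K a ∈ B.comap (algebraMap K L)) ∧
      B.comap (algebraMap K L) ≠ ⊤ ∧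
      (∀ w ∈ W, ¬ (B.comap (algebraMap K L)).valuation w < 1) ∧ ∀ y ∈ B, σ y ∈ B := by
  classical
  let : Algebra (LaurentSeries ℂ) K' := ((algebraMap K K').comp (algebraMap (LaurentSeries ℂ) K)).toAlgebra
  let : Algebra (RatFunc (LaurentSeries ℂ)) K' :=
    ((algebraMap K K').comp (algebraMap (RatFunc (LaurentSeries ℂ)) K)).toAlgebra
  have : IsScalarTower (RatFunc (LaurentSeries ℂ)) K K' := .of_algebraMap_eq fun _ => rfl
  have : IsScalarTower (LaurentSeries ℂ) (RatFunc (LaurentSeries ℂ)) K' := by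
    refine IsScalarTower.of_algebraMap_eq (R := LaurentSeries ℂ) (S := RatFunc (LaurentSeries ℂ)) fun a => ?_
    change algebraMap K K' _ = algebraMap K K' _
    rw [IsScalarTower.algebraMap_apply (LaurentSeries ℂ) (RatFunc (LaurentSeries ℂ)) K]
  have : FiniteDimensional (RatFunc (LaurentSeries ℂ)) K' := Module.Finite.trans K K'
  obtain ⟨_, htr⟩ := essFiniteType_and_trdeg_of_finite (LaurentSeries ℂ) K'
  have hgen' : Algebra.adjoin K' {α} = ⊤ := adjoin_singleton_eq_top_of_tower K hgen
  have hcomap : ∀ B : ValuationSubring L,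
      (B.comap (algebraMap K' L)).comap (algebraMap K K') = B.comap (algebraMap K L) := fun B => by
    rw [ValuationSubring.comap_comap, ← IsScalarTower.algebraMap_eq]
  have hmem : ∀ (B : ValuationSubring L) (a : K),
      algebraMap K K' a ∈ B.comap (algebraMap K' L) ↔ a ∈ B.comap (algebraMap K L) := fun B a => by
    rw [← hcomap, ValuationSubring.mem_comap (A := B.comap _)]
  obtain ⟨B, hBk, hB, hBW, hBσ⟩ := exists_valuationSubring_map_mem htr.le σ hα0 hp hω
    (by rw [hσα, IsScalarTower.algebraMap_apply K K' L]; rfl)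
    hg hgen' B₀ (fun a => (hmem B₀ _).2 (hk a))
    (fun h => hB₀ (by rw [← hcomap, h]; rfl)) hσB
    (W.image (algebraMap K K')) (by
      intro w hw
      obtain ⟨z, hz, rfl⟩ := Finset.mem_image.1 hw
      exact (_root_.map_ne_zero _).2 (hW z hz))
  refine ⟨B, fun a => (hmem B _).1 (hBk a), fun h => hB ?_, ?_, hBσ⟩
  · rw [← hcomap] at h
    rw [eq_top_iff]
    intro z _
    rcases (B.comap (algebraMap K' L)).mem_or_inv_mem z with hz | hz
    · exact hz
    let A : Subalgebra K K' :=
      { (B.comap (algebraMap K' L)).toSubring with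
        algebraMap_mem' := fun a => show a ∈ (B.comap (algebraMap K' L)).comap (algebraMap K K') by
          rw [h]; trivial }
    have h1 : z⁻¹⁻¹ ∈ A := (Algebra.IsIntegral.isIntegral (R := K) z⁻¹).inv_mem hz
    rwa [inv_inv] at h1
  · intro w hw
    rw [← hcomap, ValuationSubring.valuation_comap_lt_one_iff]
    exact hBW _ (Finset.mem_image_of_mem _ hw)

/-- A nontrivial decomposition group over one place of a Kummer extension forces nontrivial
decomposition groups over a place avoiding the zeros of given functions. -/
lemma exists_place_decompositionSubgroup_ne_bot {K L : Type} [Field K] [Field L]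
    [Algebra (LaurentSeries ℂ) K] [Algebra (RatFunc (LaurentSeries ℂ)) K]
    [IsScalarTower (LaurentSeries ℂ) (RatFunc (LaurentSeries ℂ)) K]
    [FiniteDimensional (RatFunc (LaurentSeries ℂ)) K] [Algebra K L] [FiniteDimensional K L]
    {n : ℕ} (hn : 0 < n) {f : K} (hf : f ≠ 0) {α : L} (hα : α ^ n = algebraMap K L f)
    (hgen : Algebra.adjoin K {α} = ⊤) (B₀ : ValuationSubring L)
    (hk : ∀ a, algebraMap (LaurentSeries ℂ) K a ∈ B₀.comap (algebraMap K L))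
    (hB₀ : B₀.comap (algebraMap K L) ≠ ⊤) (hdec : B₀.decompositionSubgroup K ≠ ⊥)
    (W : Finset K) (hW : ∀ w ∈ W, w ≠ 0) :
    ∃ B : ValuationSubring L,
      (∀ a, algebraMap (LaurentSeries ℂ) K a ∈ B.comap (algebraMap K L)) ∧
      B.comap (algebraMap K L) ≠ ⊤ ∧
      (∀ w ∈ W, ¬ (B.comap (algebraMap K L)).valuation w < 1) ∧ B.decompositionSubgroup K ≠ ⊥ := by
  have hα0 : α ≠ 0 := by
    rintro rfl
    rw [zero_pow hn.ne', eq_comm, _root_.map_eq_zero] at hα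
    exact hf hα
  obtain ⟨p, hp, σ, hσB, hσ⟩ : ∃ p, p.Prime ∧ ∃ σ ∈ B₀.decompositionSubgroup K, orderOf σ = p := by
    obtain ⟨⟨τ, hτ⟩, hτ1⟩ := Subgroup.ne_bot_iff_exists_ne_one.1 hdec
    replace hτ1 : τ ≠ 1 := fun h => hτ1 (Subtype.ext h)
    refine ⟨_, Nat.minFac_prime (mt orderOf_eq_one_iff.1 hτ1),
      _, pow_mem hτ (orderOf τ / (orderOf τ).minFac), ?_⟩
    exact orderOf_pow_orderOf_div (orderOf_pos τ).ne' (Nat.minFac_dvd _)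
  have hσ1 : σ ≠ 1 := by
    rintro rfl
    exact hp.one_lt.ne' (hσ.symm.trans orderOf_one)
  let j : ℂ →+* K := (algebraMap (LaurentSeries ℂ) K).comp (algebraMap ℂ (LaurentSeries ℂ))
  obtain ⟨ω, hω, hσα⟩ := exists_complex_map_eq_mul j hn hα hα0 hgen hσ1
  have hωp : ω ^ p = 1 := by
    have h1 : ∀ i : ℕ, (σ ^ i) α = algebraMap K L (j (ω ^ i)) * α := by
      intro i
      induction i with
      | zero => simp
      | succ i ih =>
        rw [pow_succ', AlgEquiv.mul_apply, ih, map_mul, AlgEquiv.commutes, hσα, pow_succ, map_mul,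
          map_mul, mul_assoc]
    have h2 := h1 p
    rw [← hσ, pow_orderOf_eq_one, AlgEquiv.one_apply, hσ, eq_comm, mul_eq_right₀ hα0] at h2
    exact ((algebraMap K L).comp j).injective (h2.trans (map_one _).symm)
  let K' := IntermediateField.fixedField (Subgroup.zpowers σ)
  have hfix : ∀ x : L, σ x = x → x ∈ K' := by
    intro x hx
    have h1 : Subgroup.zpowers σ ≤ MulAction.stabilizer (L ≃ₐ[K] L) x :=
      (Subgroup.zpowers_le).2 hx
    exact (IntermediateField.mem_fixedField_iff _ _).2 fun τ hτ => h1 hτ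
  have hg : α ^ p ∈ K' := hfix _ (by
    rw [map_pow, hσα, mul_pow, ← map_pow, ← map_pow, hωp, map_one, map_one, one_mul])
  let σ' : L ≃ₐ[K'] L := AlgEquiv.ofRingEquiv (f := (σ : L ≃+* L)) fun x =>
    (IntermediateField.mem_fixedField_iff _ _).1 x.2 σ (Subgroup.mem_zpowers σ)
  obtain ⟨B, hBk, hB, hBW, hBσ⟩ := exists_valuationSubring_map_mem_of_tower σ' hα0 hp hω hσα
    (g := ⟨α ^ p, hg⟩) rfl hgen B₀ hk hB₀ ((B₀.mem_decompositionSubgroup_iff σ).1 hσB) W hW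
  refine ⟨B, hBk, hB, hBW, fun h => ?_⟩
  have h1 := B.mem_decompositionSubgroup_of_isOfFinOrder (isOfFinOrder_of_finite σ) hBσ
  rw [h] at h1
  exact hσ1 h1

/-- Let `K` be the function field of a smooth projective curve over `ℂ((t))`
(equivalently, a finite extension of `ℂ((t))(u)`), let `n ≥ 1`, let `f ∈ K^×`, let `α` be
an `n`-th root of `f` and `L := K(α)`; the extension `L/K` is Galois since `ℂ ⊆ K`
contains all `n`-th roots of unity. If all but finitely many places of `K` (valuation
subrings `≠ K` containing the image of `ℂ((t))`) are totally split in `L/K` (all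
decomposition groups of extensions to `L` are trivial), then every place of `K` is
totally split in `L/K`. -/
theorem stmt_4 (K L : Type) [Field K] [Field L]
    [Algebra (LaurentSeries ℂ) K]
    [Algebra (RatFunc (LaurentSeries ℂ)) K]
    [IsScalarTower (LaurentSeries ℂ) (RatFunc (LaurentSeries ℂ)) K]
    [FiniteDimensional (RatFunc (LaurentSeries ℂ)) K]
    [Algebra K L] [IsGalois K L] [FiniteDimensional K L]
    (n : ℕ) (hn : 1 ≤ n) (f : K) (hf : f ≠ 0)
    (α : L) (hα : α ^ n = algebraMap K L f)
    (hgen : Algebra.adjoin K {α} = ⊤)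
    (hfin : {v : ValuationSubring K | v ≠ ⊤ ∧
      (∀ a : LaurentSeries ℂ, algebraMap (LaurentSeries ℂ) K a ∈ v) ∧
      ¬ (∀ B : ValuationSubring L, B.comap (algebraMap K L) = v →
          B.decompositionSubgroup K = ⊥)}.Finite) :
    ∀ v : ValuationSubring K, v ≠ ⊤ →
      (∀ a : LaurentSeries ℂ, algebraMap (LaurentSeries ℂ) K a ∈ v) →
      ∀ B : ValuationSubring L, B.comap (algebraMap K L) = v →
        B.decompositionSubgroup K = ⊥ := by
  intro v₀ hv₀ hk B₀ hB₀
  by_contra hdec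
  subst hB₀
  have hex : ∀ v : ValuationSubring K, ∃ w : K, w ≠ 0 ∧ (v ≠ ⊤ → v.valuation w < 1) := by
    intro v
    by_cases hv : v = ⊤
    · exact ⟨1, one_ne_zero, fun h => absurd hv h⟩
    · obtain ⟨z, hz⟩ : ∃ z, z ∉ v := by
        by_contra! h
        exact hv (eq_top_iff.2 fun z _ => h z)
      have hz0 : z ≠ 0 := by
        rintro rfl
        exact hz v.zero_mem
      refine ⟨z⁻¹, inv_ne_zero hz0, fun _ => ?_⟩
      rwa [ValuationSubring.valuation_lt_one_iff_inv_notMem _ (inv_ne_zero hz0), inv_inv]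
  choose w hw0 hw using hex
  classical
  obtain ⟨B, hBk, hB, hBW, hBdec⟩ := exists_place_decompositionSubgroup_ne_bot hn hf hα hgen B₀ hk hv₀
    hdec (hfin.toFinset.image w) (by
      intro z hz
      obtain ⟨v, -, rfl⟩ := Finset.mem_image.1 hz
      exact hw0 v)
  refine hBW (w (B.comap (algebraMap K L))) (Finset.mem_image_of_mem _ ?_) (hw _ hB)
  exact hfin.mem_toFinset.2 ⟨hB, hBk, fun h => hBdec (h B rfl)⟩
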